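/- Let 1 ≤ r ≤ 2m−1 with r ≠ m. Let I_r be the set of totally isotropic r-dimensional subspaces of V if r < m, and I_r = {W^⊥ : W a totally isotropic (2m−r)-dimensional subspace} if r > m, where W^⊥ = {v ∈ V : ⟨v,w⟩ = 0 for all w ∈ W}. Then the k-span in k[P] of {χ_U : U ∈ I_r} is the internal direct sum of k·1 (the constant functions on P) and the k-span of the induced functions f̂, as f ranges over all basis monomials whose H-type s' lies in H and satisfies s'_j ≤ 2m−r for all j. -/

import Mathlib

open scoped Classical

noncomputable section

/-- The `2m`-dimensional standard symplectic space over `k = F_q = GaloisField p t`. -/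
abbrev SympV (p t m : ℕ) [Fact p.Prime] : Type :=
  (Fin m → GaloisField p t) × (Fin m → GaloisField p t)

/-- The nonsingular alternating bilinear form
`⟨(x,y),(x',y')⟩ = Σ_i (x_i y'_i − y_i x'_i)`. -/
def sform {p t m : ℕ} [Fact p.Prime] (v w : SympV p t m) : GaloisField p t :=
  ∑ i, (v.1 i * w.2 i - v.2 i * w.1 i)

/-- The form, linear in its first argument (second argument fixed). -/
def sformR {p t m : ℕ} [Fact p.Prime] (w : SympV p t m) :
    SympV p t m →ₗ[GaloisField p t] GaloisField p t where
  toFun v := sform v w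
  map_add' u v := by
    simp only [sform, Prod.fst_add, Prod.snd_add, Pi.add_apply]
    rw [← Finset.sum_add_distrib]
    exact Finset.sum_congr rfl fun i _ => by ring
  map_smul' c v := by
    simp only [sform, Prod.smul_fst, Prod.smul_snd, Pi.smul_apply, smul_eq_mul,
      RingHom.id_apply]
    rw [Finset.mul_sum]
    exact Finset.sum_congr rfl fun i _ => by ring

/-- `W^⊥ = {v ∈ V : ⟨v,w⟩ = 0 for all w ∈ W}`. -/
def sperp {p t m : ℕ} [Fact p.Prime]
    (W : Submodule (GaloisField p t) (SympV p t m)) :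
    Submodule (GaloisField p t) (SympV p t m) :=
  ⨅ w ∈ W, LinearMap.ker (sformR w)

/-- A subspace is totally isotropic if the form vanishes identically on it. -/
def IsTotIso {p t m : ℕ} [Fact p.Prime]
    (W : Submodule (GaloisField p t) (SympV p t m)) : Prop :=
  ∀ u ∈ W, ∀ w ∈ W, sform u w = 0

/-- `P`: the set of points (1-dimensional subspaces) of `V`. -/
abbrev Pts (p t m : ℕ) [Fact p.Prime] : Type :=
  {Z : Submodule (GaloisField p t) (SympV p t m) //
    Module.finrank (GaloisField p t) Z = 1}

/-- The characteristic function `χ_U ∈ k[P]` of a subspace `U ⊆ V`. -/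
def chi {p t m : ℕ} [Fact p.Prime]
    (U : Submodule (GaloisField p t) (SympV p t m)) :
    Pts p t m → GaloisField p t :=
  fun Z => if Z.val ≤ U then 1 else 0

/-- The basis monomial `∏_i x_i^{a_i} y_i^{b_i}` as a function `V → k`. -/
def bmono {p t m : ℕ} [Fact p.Prime] (a b : Fin m → ℕ) :
    SympV p t m → GaloisField p t :=
  fun v => ∏ i, (v.1 i ^ a i * v.2 i ^ b i)

/-- The type of the basis monomial with exponents `a, b`:
`λ_j = Σ_i (a_{ij} + b_{ij})`, sums of `j`-th `p`-adic digits. -/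
def mtype (p : ℕ) {m : ℕ} (a b : Fin m → ℕ) (j : ℕ) : ℕ :=
  ∑ i, (a i / p ^ j % p + b i / p ^ j % p)

/-- Membership in `H`: `1 ≤ s_j ≤ 2m−1` and `0 ≤ p·s_{j+1} − s_j ≤ 2m(p−1)`. -/
def memH (p t m : ℕ) [NeZero t] (s : Fin t → ℤ) : Prop :=
  (∀ j, 1 ≤ s j ∧ s j ≤ 2 * m - 1) ∧
  (∀ j : Fin t, 0 ≤ (p : ℤ) * s (j + 1) - s j ∧
    (p : ℤ) * s (j + 1) - s j ≤ 2 * m * ((p : ℤ) - 1))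

namespace IE

section arith

variable {p : ℕ} [hp : Fact p.Prime]

lemma vsub (t s : ℕ) (h0 : 0 < s) (h : s < p ^ t) :
    padicValNat p (p ^ t - s) = padicValNat p s := by
  have key : ∀ k, k ≤ padicValNat p s ↔ k ≤ padicValNat p (p ^ t - s) := by
    intro k
    rw [← padicValNat_dvd_iff_le (by omega), ← padicValNat_dvd_iff_le (by omega)]
    constructor
    · intro hk
      have : k ≤ t := by
        by_contra hc
        have h1 := Nat.le_of_dvd h0 hk
        have h2 : p ^ t ≤ p ^ k := Nat.pow_le_pow_right hp.out.pos (by omega)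
        omega
      exact Nat.dvd_sub (pow_dvd_pow p this) hk
    · intro hk
      have : k ≤ t := by
        by_contra hc
        have h1 := Nat.le_of_dvd (by omega) hk
        have h2 : p ^ t ≤ p ^ k := Nat.pow_le_pow_right hp.out.pos (by omega)
        omega
      have := Nat.dvd_sub (pow_dvd_pow p this) hk
      rwa [Nat.sub_sub_self h.le] at this
  apply le_antisymm
  · exact (key _).2 le_rfl
  · exact (key _).1 le_rfl

lemma vchoose (t a i : ℕ) (ha : 1 ≤ a) (h : a + i ≤ p ^ t) :
    padicValNat p ((p ^ t - a).choose i) = padicValNat p ((a + i - 1).choose i) := by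
  induction i with
  | zero => simp
  | succ i ih =>
    have ih := ih (by omega)
    have e1 := Nat.choose_succ_right_eq (p ^ t - a) i
    have e2 : (a + (i+1) - 1).choose (i+1) * (i+1) = (a + i - 1).choose i * (a + i) := by
      have := Nat.add_one_mul_choose_eq (a + i - 1) i
      rw [show a + i - 1 + 1 = a + i by omega] at this
      rw [show a + (i+1) - 1 = a + i by omega, ← this, mul_comm]
    have n1 : (p ^ t - a).choose (i+1) ≠ 0 := (Nat.choose_pos (by omega)).ne'
    have n2 : (p ^ t - a).choose i ≠ 0 := (Nat.choose_pos (by omega)).ne'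
    have n3 : (a + (i+1) - 1).choose (i+1) ≠ 0 := (Nat.choose_pos (by omega)).ne'
    have n4 : (a + i - 1).choose i ≠ 0 := (Nat.choose_pos (by omega)).ne'
    have f1 := congrArg (padicValNat p) e1
    have f2 := congrArg (padicValNat p) e2
    rw [padicValNat.mul n1 (by omega), padicValNat.mul n2 (by omega)] at f1
    rw [padicValNat.mul n3 (by omega), padicValNat.mul n4 (by omega)] at f2
    have := vsub (p := p) t (a + i) (by omega) (by omega)
    rw [Nat.sub_sub] at f1
    omega

lemma vchooseN (t n i : ℕ) (hp2 : p ≠ 2) (hn : 2 * n + 1 = p ^ t) (h : i ≤ n) :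
    padicValNat p (n.choose i) = padicValNat p ((2 * i).choose i) := by
  induction i with
  | zero => simp
  | succ i ih =>
    have ih := ih (by omega)
    have e1 := Nat.choose_succ_right_eq n i
    have e2 := Nat.succ_mul_centralBinom_succ i
    unfold Nat.centralBinom at e2
    have v2 : padicValNat p 2 = 0 := by
      apply padicValNat.eq_zero_of_not_dvd
      intro hd
      exact hp2 ((Nat.prime_dvd_prime_iff_eq hp.out Nat.prime_two).1 hd)
    have n1 : n.choose (i+1) ≠ 0 := (Nat.choose_pos (by omega)).ne'
    have n2 : n.choose i ≠ 0 := (Nat.choose_pos (by omega)).ne'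
    have n3 : (2 * (i+1)).choose (i+1) ≠ 0 := (Nat.choose_pos (by omega)).ne'
    have n4 : (2 * i).choose i ≠ 0 := (Nat.choose_pos (by omega)).ne'
    have f1 := congrArg (padicValNat p) e1
    have f2 := congrArg (padicValNat p) e2
    rw [padicValNat.mul n1 (by omega), padicValNat.mul n2 (by omega)] at f1
    rw [padicValNat.mul (by omega) n3, padicValNat.mul (by omega) n4,
      padicValNat.mul (by omega) (by omega)] at f2
    have g := vsub (p := p) t (2 * i + 1) (by omega) (by omega)
    rw [← hn, show 2 * n + 1 - (2 * i + 1) = 2 * (n - i) by omega,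
      padicValNat.mul (by omega) (by omega)] at g
    omega

lemma ndvd_iff {a b : ℕ} (ha : a ≠ 0) (hb : b ≠ 0) (h : padicValNat p a = padicValNat p b) :
    p ∣ a ↔ p ∣ b := by
  rw [dvd_iff_padicValNat_ne_zero ha, dvd_iff_padicValNat_ne_zero hb, h]

lemma choose_top_ndvd (t i : ℕ) (h : i < p ^ t) : ¬ p ∣ (p ^ t - 1).choose i := by
  rw [ndvd_iff (b := (1 + i - 1).choose i) (Nat.choose_pos (by omega)).ne'
    (by rw [Nat.add_sub_cancel_left]; simp) (vchoose t 1 i le_rfl (by omega))]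
  rw [Nat.add_sub_cancel_left]; simpa using hp.out.one_lt.ne'

lemma choose_bot_ndvd (t n i : ℕ) (hp2 : p ≠ 2) (hn : 2 * n + 1 = p ^ t) (h : i ≤ n)
    (hd : ¬ p ∣ n.choose i) : ¬ p ∣ (i + i).choose i := by
  rwa [← two_mul, ← ndvd_iff (Nat.choose_pos h).ne' (Nat.choose_pos (by omega)).ne'
    (vchooseN t n i hp2 hn h)]

lemma choose_mid_ndvd (t n i : ℕ) (hp2 : p ≠ 2) (hn : 2 * n + 1 = p ^ t) (h : i ≤ n)
    (hd : ¬ p ∣ n.choose i) : ¬ p ∣ (p ^ t - 1 - i).choose i := by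
  have h1 := choose_bot_ndvd t n i hp2 hn h hd
  have h2 := vchoose (p := p) t (i + 1) i (by omega) (by omega)
  rw [show i + 1 + i - 1 = i + i by omega, show p ^ t - (i + 1) = p ^ t - 1 - i by omega] at h2
  rwa [ndvd_iff (Nat.choose_pos (by omega)).ne' (Nat.choose_pos (by omega)).ne' h2]

end arith

section sums
variable {K : Type*} [Field K] [Fintype K]

local notation "q" => Fintype.card K

lemma sum_pow_all (j : ℕ) :
    ∑ c : K, c ^ j = if j ≠ 0 ∧ (q - 1) ∣ j then (-1 : K) else 0 := by
  by_cases hj : j = 0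
  · subst hj; simp
  have h := FiniteField.sum_pow_units K j
  have h2 : ∑ c : K, c ^ j = ∑ c : Kˣ, (c : K) ^ j := by
    rw [← Finset.sum_erase (s := Finset.univ) (a := (0:K)) (by simp [hj])]
    symm
    refine Finset.sum_bij (fun c _ => (c : K)) ?_ ?_ ?_ ?_
    · intro a _; simp
    · intro a _ b _ h; exact Units.ext h
    · intro b hb; simp at hb; exact ⟨Units.mk0 b hb, by simp, rfl⟩
    · intro a _; rfl
  rw [h2]
  simp only [ne_eq, hj, not_false_eq_true, true_and]
  rw [← h]

lemma pow_card_sub (x : K) (b : ℕ) (hb : q ≤ b) : x ^ b = x ^ (b - (q - 1)) := by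
  have hq : 1 < q := Fintype.one_lt_card
  obtain ⟨k, rfl⟩ := Nat.exists_eq_add_of_le hb
  rw [pow_add, FiniteField.pow_card, show q + k - (q-1) = k + 1 by omega, pow_succ, mul_comm]

/-- single coefficient extraction -/
lemma L1 (x y : K) (a l : ℕ) (hl : 1 ≤ l) (hl2 : l + 1 < q) (ha : a ≤ q - 1) :
    ∑ c : K, c ^ (q - 1 - l) * (x + c * y) ^ a = -((a.choose l : K) * x ^ (a - l) * y ^ l) := by
  have : ∀ c : K, c ^ (q - 1 - l) * (x + c * y) ^ a =
      ∑ i ∈ Finset.range (a + 1), ((a.choose i : K) * x ^ (a - i) * y ^ i) * c ^ (q - 1 - l + i) := by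
    intro c
    rw [add_comm x, add_pow, Finset.mul_sum]
    refine Finset.sum_congr rfl fun i _ => ?_
    rw [mul_pow, pow_add]; ring
  simp_rw [this]
  rw [Finset.sum_comm]
  simp_rw [← Finset.mul_sum, sum_pow_all]
  have h2 : ∀ i ∈ Finset.range (a+1), ((a.choose i : K) * x ^ (a - i) * y ^ i) *
      (if q - 1 - l + i ≠ 0 ∧ (q - 1) ∣ q - 1 - l + i then (-1:K) else 0) =
      if i = l then -((a.choose l : K) * x ^ (a - l) * y ^ l) else 0 := by
    intro i hi
    rw [Finset.mem_range] at hi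
    by_cases h : i = l
    · subst h
      rw [if_pos ⟨by omega, by rw [Nat.sub_add_cancel (by omega)]⟩]; simp
    · rw [if_neg, if_neg h, mul_zero]
      rintro ⟨h0, k, hk⟩
      have : k = 1 := by
        have h1 : k ≠ 0 := by rintro rfl; omega
        by_contra h2
        have : 2 ≤ k := by omega
        have := Nat.mul_le_mul_left (q-1) this
        omega
      subst this; omega
  rw [Finset.sum_congr rfl h2, Finset.sum_ite_eq']
  split_ifs with h
  · rfl
  · rw [Nat.choose_eq_zero_of_lt (by simpa using h)]; simp

/-- the double extraction -/
lemma L2 (n : ℕ) (hn : 2 * n + 1 = q) (x y z w : K) :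
    ∑ c : K, c ^ (q - 1 - n) * ((x + c * y) ^ n * (z + c * w) ^ (q - 1)) =
     -(∑ i ∈ Finset.range (n + 1), (n.choose i : K) * ((q - 1).choose i : K) *
        (x ^ i * y ^ (n - i) * z ^ (q - 1 - i) * w ^ i) + y ^ n * w ^ (q - 1)) := by
  have hq : 1 < q := Fintype.one_lt_card
  have hn1 : 1 ≤ n := by omega
  let G : ℕ → ℕ → K := fun i k => (n.choose i : K) * ((q - 1).choose k : K) *
        (x ^ i * y ^ (n - i) * z ^ (q - 1 - k) * w ^ k)
  have e : ∀ c : K, c ^ (q - 1 - n) * ((x + c * y) ^ n * (z + c * w) ^ (q - 1)) =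
      ∑ i ∈ Finset.range (n + 1), ∑ k ∈ Finset.range (q - 1 + 1),
       G i k * c ^ (q - 1 - n + (n - i) + k) := by
    intro c
    rw [add_pow, add_comm z, add_pow, Finset.sum_mul_sum, Finset.mul_sum]
    refine Finset.sum_congr rfl fun i _ => ?_
    rw [Finset.mul_sum]
    refine Finset.sum_congr rfl fun k _ => ?_
    rw [mul_pow, mul_pow, pow_add, pow_add]; simp only [G]; ring
  simp_rw [e]
  rw [Finset.sum_comm]
  simp_rw [Finset.sum_comm (s := Finset.univ) (t := Finset.range (q - 1 + 1)), ← Finset.mul_sum,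
    sum_pow_all]
  have h2 : ∀ i ∈ Finset.range (n+1), ∑ k ∈ Finset.range (q - 1 + 1), G i k *
      (if q - 1 - n + (n - i) + k ≠ 0 ∧ (q - 1) ∣ q - 1 - n + (n - i) + k then (-1:K) else 0) =
      - G i i - (if i = 0 then G 0 (q - 1) else 0) := by
    intro i hi
    rw [Finset.mem_range] at hi
    have h3 : ∀ k ∈ Finset.range (q - 1 + 1), G i k *
      (if q - 1 - n + (n - i) + k ≠ 0 ∧ (q - 1) ∣ q - 1 - n + (n - i) + k then (-1:K) else 0) =
       (if k = i then - G i i else 0) + (if k = q - 1 then - (if i = 0 then G 0 (q - 1) else 0) else 0) := by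
      intro k hk
      rw [Finset.mem_range] at hk
      by_cases h : k = i
      · subst h
        rw [if_pos ⟨by omega, ⟨1, by omega⟩⟩, if_pos rfl, if_neg (by omega)]; ring
      · rw [if_neg h, zero_add]
        by_cases h' : k = q - 1 ∧ i = 0
        · obtain ⟨rfl, rfl⟩ := h'
          rw [if_pos ⟨by omega, ⟨2, by omega⟩⟩]; simp
        · rw [if_neg]
          · split_ifs <;> simp_all
          rintro ⟨h0, j, hj⟩
          have h4 : j ≠ 0 := by rintro rfl; omega
          have h5 : j < 3 := by
            by_contra h2
            have : 3 ≤ j := by omega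
            have := Nat.mul_le_mul_left (q-1) this
            omega
          interval_cases j
          · omega
          · omega
          · omega
    rw [Finset.sum_congr rfl h3, Finset.sum_add_distrib, Finset.sum_ite_eq', Finset.sum_ite_eq',
      if_pos (by rw [Finset.mem_range]; omega), if_pos (by rw [Finset.mem_range]; omega)]; ring
  rw [Finset.sum_congr rfl h2, Finset.sum_sub_distrib, Finset.sum_ite_eq',
    if_pos (by simp), Finset.sum_neg_distrib]
  simp only [G]; simp; ring

end sums
end IE

namespace IE

section basics
variable {p t m : ℕ} [hp : Fact p.Prime]

local notation "𝕂" => GaloisField p t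
local notation "𝕍" => SympV p t m

instance instFintypeGF (p t : ℕ) [Fact p.Prime] : Fintype (GaloisField p t) := Fintype.ofFinite _

lemma cardK (ht : t ≠ 0) : Fintype.card (GaloisField p t) = p ^ t := by
  rw [← GaloisField.card p t ht, Nat.card_eq_fintype_card]

lemma sform_add_left (u v w : 𝕍) : sform (u + v) w = sform u w + sform v w :=
  (sformR w).map_add u v
lemma sform_smul_left (c : 𝕂) (v w : 𝕍) : sform (c • v) w = c * sform v w :=
  (sformR w).map_smul c v
lemma sform_swap (v w : 𝕍) : sform w v = - sform v w := by
  simp only [sform]; rw [← Finset.sum_neg_distrib]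
  exact Finset.sum_congr rfl fun i _ => by ring
lemma sform_self (v : 𝕍) : sform v v = 0 := by
  simp only [sform]; exact Finset.sum_eq_zero fun i _ => by ring
lemma sform_add_right (u v w : 𝕍) : sform u (v + w) = sform u v + sform u w := by
  rw [sform_swap, sform_add_left, sform_swap u v, sform_swap u w]; ring
lemma sform_smul_right (c : 𝕂) (v w : 𝕍) : sform v (c • w) = c * sform v w := by
  rw [sform_swap, sform_smul_left, sform_swap v w]; ring
lemma sform_zero_left (v : 𝕍) : sform 0 v = 0 := (sformR v).map_zero
lemma sform_zero_right (v : 𝕍) : sform v 0 = 0 := by rw [sform_swap, sform_zero_left, neg_zero]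
lemma sform_comm_zero {v w : 𝕍} (h : sform v w = 0) : sform w v = 0 := by
  rw [sform_swap, h, neg_zero]

lemma mem_sperp {W : Submodule 𝕂 𝕍} {v : 𝕍} : v ∈ sperp W ↔ ∀ w ∈ W, sform v w = 0 := by
  simp [sperp, sformR]

def sB : LinearMap.BilinForm 𝕂 𝕍 :=
  LinearMap.mk₂ 𝕂 sform sform_add_left (fun c v w => sform_smul_left c v w)
    sform_add_right (fun c v w => sform_smul_right c v w)

lemma sB_refl : (sB : LinearMap.BilinForm 𝕂 𝕍).IsRefl := fun _ _ h => sform_comm_zero h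

lemma sform_nondeg (v : 𝕍) (h : ∀ w, sform v w = 0) : v = 0 := by
  ext i
  · have := h (0, Pi.single i 1)
    simpa [sform, Pi.single_apply] using this
  · have := h (Pi.single i 1, 0)
    simpa [sform, Pi.single_apply] using this

lemma sB_nondeg : (sB : LinearMap.BilinForm 𝕂 𝕍).Nondegenerate :=
  ⟨fun v h => sform_nondeg v h, fun v h => sform_nondeg v fun w => sform_comm_zero (h w)⟩

lemma sperp_eq (W : Submodule 𝕂 𝕍) : sperp W = sB.orthogonal W := by
  ext v; rw [mem_sperp, LinearMap.BilinForm.mem_orthogonal_iff]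
  exact ⟨fun h w hw => sform_comm_zero (h w hw), fun h w hw => sform_comm_zero (h w hw)⟩

lemma finrankV : Module.finrank 𝕂 𝕍 = 2 * m := by
  rw [Module.finrank_prod]; simp; ring

lemma finrank_sperp (W : Submodule 𝕂 𝕍) :
    Module.finrank 𝕂 (sperp W) + Module.finrank 𝕂 W = 2 * m := by
  have h := W.finrank_le
  rw [sperp_eq, LinearMap.BilinForm.finrank_orthogonal sB_nondeg]
  rw [finrankV] at *; omega

lemma sperp_sperp (W : Submodule 𝕂 𝕍) : sperp (sperp W) = W := by
  rw [sperp_eq, sperp_eq, LinearMap.BilinForm.orthogonal_orthogonal sB_nondeg sB_refl]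

lemma sperp_anti {U W : Submodule 𝕂 𝕍} (h : U ≤ W) : sperp W ≤ sperp U := fun v hv =>
  mem_sperp.2 fun w hw => mem_sperp.1 hv w (h hw)

lemma sperp_sup (U W : Submodule 𝕂 𝕍) : sperp (U ⊔ W) = sperp U ⊓ sperp W := by
  apply le_antisymm (le_inf (sperp_anti le_sup_left) (sperp_anti le_sup_right))
  rintro v ⟨h1, h2⟩
  rw [mem_sperp]; intro w hw
  obtain ⟨a, ha, b, hb, rfl⟩ := Submodule.mem_sup.1 hw
  rw [sform_add_right, mem_sperp.1 h1 a ha, mem_sperp.1 h2 b hb, add_zero]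

lemma sperp_inf (U W : Submodule 𝕂 𝕍) : sperp (U ⊓ W) = sperp U ⊔ sperp W := by
  rw [← sperp_sperp (sperp U ⊔ sperp W), sperp_sup, sperp_sperp, sperp_sperp]

/-- hyperplane orthogonal to a vector -/
def hyp (w : 𝕍) : Submodule 𝕂 𝕍 := LinearMap.ker (sformR w)
lemma mem_hyp {v w : 𝕍} : v ∈ hyp w ↔ sform v w = 0 := Iff.rfl

lemma sperp_span (w : 𝕍) : sperp (Submodule.span 𝕂 {w}) = hyp w := by
  ext v; rw [mem_sperp, mem_hyp]
  constructor
  · intro h; exact h w (Submodule.mem_span_singleton_self w)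
  · intro h u hu
    obtain ⟨c, rfl⟩ := Submodule.mem_span_singleton.1 hu
    rw [sform_smul_right, h, mul_zero]

lemma sperp_inf_hyp (U : Submodule 𝕂 𝕍) (s : 𝕍) :
    sperp (U ⊓ hyp s) = sperp U ⊔ Submodule.span 𝕂 {s} := by
  rw [← sperp_span, sperp_inf, sperp_sperp]

lemma finrank_sup_span {U : Submodule 𝕂 𝕍} {s : 𝕍} (h : s ∉ U) :
    Module.finrank 𝕂 (U ⊔ Submodule.span 𝕂 {s} : Submodule 𝕂 𝕍) = Module.finrank 𝕂 U + 1 := by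
  have h0 : s ≠ 0 := by rintro rfl; exact h U.zero_mem
  have h1 := Submodule.finrank_sup_add_finrank_inf_eq U (Submodule.span 𝕂 {s})
  rw [finrank_span_singleton h0] at h1
  have h2 : U ⊓ Submodule.span 𝕂 {s} = ⊥ := by
    rw [eq_bot_iff]; rintro v ⟨hv, hs⟩
    obtain ⟨c, rfl⟩ := Submodule.mem_span_singleton.1 hs
    by_cases hc : c = 0
    · simp [hc]
    · exact absurd ((U.smul_mem_iff hc).1 hv) h
  rw [h2, finrank_bot] at h1; exact h1

lemma finrank_sup_span_le (U : Submodule 𝕂 𝕍) (s : 𝕍) :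
    Module.finrank 𝕂 (U ⊔ Submodule.span 𝕂 {s} : Submodule 𝕂 𝕍) ≤ Module.finrank 𝕂 U + 1 := by
  by_cases h : s ∈ U
  · rw [sup_eq_left.2 (by simpa using h)]; omega
  · rw [finrank_sup_span h]

lemma finrank_inf_hyp {U : Submodule 𝕂 𝕍} {s : 𝕍} (h : s ∉ sperp U) :
    Module.finrank 𝕂 (U ⊓ hyp s : Submodule 𝕂 𝕍) + 1 = Module.finrank 𝕂 U := by
  have h1 := finrank_sperp U
  have h2 := finrank_sperp (U ⊓ hyp s)
  rw [sperp_inf_hyp, finrank_sup_span h] at h2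
  omega

lemma finrank_inf_hyp_le (U : Submodule 𝕂 𝕍) (s : 𝕍) :
    Module.finrank 𝕂 U ≤ Module.finrank 𝕂 (U ⊓ hyp s : Submodule 𝕂 𝕍) + 1 := by
  have h1 := finrank_sperp U
  have h2 := finrank_sperp (U ⊓ hyp s)
  rw [sperp_inf_hyp] at h2
  have := finrank_sup_span_le (sperp U) s
  omega

/-- indicator of a subspace -/
def ind (U : Submodule 𝕂 𝕍) : 𝕍 → 𝕂 := fun v => if v ∈ U then 1 else 0
/-- power of a linear form -/
def Xf (w : 𝕍) : 𝕍 → 𝕂 := fun v => sform v w ^ (p ^ t - 1)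

lemma pow_q1 (ht : t ≠ 0) (x : 𝕂) : x ^ (p ^ t - 1) = if x = 0 then 0 else 1 := by
  have hq : 1 < p ^ t := Nat.one_lt_pow ht hp.out.one_lt
  split_ifs with h
  · rw [h, zero_pow (by omega)]
  · rw [← cardK ht]; exact FiniteField.pow_card_sub_one_eq_one x h

lemma ind_top : (ind ⊤ : 𝕍 → 𝕂) = 1 := by ext v; simp [ind]

lemma ind_inf_hyp (ht : t ≠ 0) (U : Submodule 𝕂 𝕍) (w : 𝕍) :
    ind (U ⊓ hyp w) = ind U * (1 - Xf w) := by
  ext v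
  simp only [ind, Submodule.mem_inf, mem_hyp, Pi.mul_apply, Pi.sub_apply, Pi.one_apply, Xf,
    pow_q1 ht]
  split_ifs <;> simp_all

lemma ind_mul_X (ht : t ≠ 0) (U : Submodule 𝕂 𝕍) (w : 𝕍) :
    ind U * Xf w = ind U - ind (U ⊓ hyp w) := by
  rw [ind_inf_hyp ht]; ring

lemma X_eq (ht : t ≠ 0) (w : 𝕍) : Xf w = 1 - ind (hyp w) := by
  have := ind_mul_X ht ⊤ w
  rwa [ind_top, one_mul, top_inf_eq] at this

lemma LS (ht : t ≠ 0) (Q : Submodule 𝕂 𝕍) (s s' : 𝕍) :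
    ind Q = ∑ c : 𝕂, ind (Q ⊓ hyp (s + c • s')) + ind (Q ⊓ hyp s') := by
  ext v
  simp only [Pi.add_apply, Finset.sum_apply, ind, Submodule.mem_inf, mem_hyp]
  by_cases hv : v ∈ Q
  swap
  · simp [hv]
  simp only [hv, true_and, sform_add_right, sform_smul_right, if_true]
  by_cases h' : sform v s' = 0
  · simp only [h', mul_zero, add_zero, if_true]
    by_cases h : sform v s = 0
    · simp only [h, if_true, Finset.sum_const, Finset.card_univ, nsmul_eq_mul, mul_one]
      rw [cardK ht]; 
      have : (p : 𝕂) = 0 := CharP.cast_eq_zero _ p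
      simp [this, ht]
    · simp [h]
  · simp only [h', if_false, add_zero]
    have : ∀ c : 𝕂, (sform v s + c * sform v s' = 0) ↔ c = - sform v s / sform v s' := by
      intro c
      rw [eq_div_iff h']
      constructor
      · intro h; linear_combination h
      · intro h; linear_combination h
    simp [this]

lemma exists_not_mem_of_finrank_lt {A B : Submodule 𝕂 𝕍}
    (h : Module.finrank 𝕂 A < Module.finrank 𝕂 B) : ∃ x ∈ B, x ∉ A := by
  by_contra hc
  push Not at hc
  have := Submodule.finrank_mono (show B ≤ A from hc)
  omega

lemma LSgen (ht : t ≠ 0) (N : Submodule 𝕂 (𝕍 → 𝕂)) (Q S : Submodule 𝕂 𝕍)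
    (hd : Module.finrank 𝕂 (sperp Q) + 2 ≤ Module.finrank 𝕂 S)
    (h : ∀ s ∈ S, s ∉ sperp Q → ind (Q ⊓ hyp s) ∈ N) : ind Q ∈ N := by
  obtain ⟨s', hs', hn'⟩ := exists_not_mem_of_finrank_lt (A := sperp Q) (B := S) (by omega)
  obtain ⟨s, hs, hn⟩ := exists_not_mem_of_finrank_lt (A := sperp Q ⊔ Submodule.span 𝕂 {s'}) (B := S)
    (by rw [finrank_sup_span hn']; omega)
  rw [LS ht Q s s']
  refine N.add_mem (N.sum_mem fun c _ => h _ (S.add_mem hs (S.smul_mem c hs')) ?_) (h s' hs' hn')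
  intro hc
  apply hn
  have : s = (s + c • s') + (-c) • s' := by simp
  rw [this]
  exact Submodule.add_mem_sup hc (Submodule.smul_mem _ _ (Submodule.mem_span_singleton_self s'))

lemma ind_ge (ht : t ≠ 0) (N : Submodule 𝕂 (𝕍 → 𝕂)) (r : ℕ) (hr : 1 ≤ r)
    (h : ∀ U : Submodule 𝕂 𝕍, Module.finrank 𝕂 U = r → ind U ∈ N)
    (U : Submodule 𝕂 𝕍) (hU : r ≤ Module.finrank 𝕂 U) : ind U ∈ N := by
  obtain ⟨k, hk⟩ := Nat.exists_eq_add_of_le hU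
  induction k generalizing U with
  | zero => exact h U hk
  | succ k ih =>
    apply LSgen ht N U ⊤
    · have := finrank_sperp U
      rw [finrank_top, finrankV]; omega
    · intro s _ hs
      have := finrank_inf_hyp hs
      exact ih _ (by omega) (by omega)

lemma prod_mem (ht : t ≠ 0) (N : Submodule 𝕂 (𝕍 → 𝕂)) (r : ℕ)
    (h : ∀ U : Submodule 𝕂 𝕍, r ≤ Module.finrank 𝕂 U → ind U ∈ N) (l : List 𝕍)
    (U : Submodule 𝕂 𝕍) (hU : r + l.length ≤ Module.finrank 𝕂 U) :
    ind U * (l.map Xf).prod ∈ N := by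
  induction l generalizing U with
  | nil => simpa using h U (by simpa using hU)
  | cons w l ih =>
    rw [List.map_cons, List.prod_cons, ← mul_assoc, ind_mul_X ht, sub_mul]
    simp only [List.length_cons] at hU
    have := finrank_inf_hyp_le U w
    exact N.sub_mem (ih _ (by omega)) (ih _ (by omega))

end basics
end IE

namespace IE

lemma isolation {K E : Type*} [Field K] [AddCommGroup E] [Module K E] (N : Submodule K E)
    (n : ℕ) (A : ℕ → K) (h : ℕ → E) (hA : A 0 ≠ 0)
    (hs : ∑ i ∈ Finset.range (n + 1), A i • h i ∈ N)
    (O : ℕ → E →ₗ[K] E) (hO : ∀ l, 1 ≤ l → l ≤ n → ∀ f ∈ N, O l f ∈ N)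
    (κ : ℕ → ℕ → K)
    (hκ : ∀ l i, 1 ≤ l → l ≤ n → 1 ≤ i → i ≤ n → O l (h i) = κ l i • h i)
    (hκ0 : ∀ l i, 1 ≤ l → l ≤ n → 1 ≤ i → i < l → κ l i = 0)
    (hκ1 : ∀ l, 1 ≤ l → l ≤ n → A l ≠ 0 → κ l l ≠ 0)
    (h0 : ∀ l, 1 ≤ l → l ≤ n → O l (h 0) ∈ N) : h 0 ∈ N := by
  have key : ∀ k l, l + k = n → 1 ≤ l → ∀ i, l ≤ i → i ≤ n → A i • h i ∈ N := by
    intro k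
    induction k with
    | zero | succ k ih => ?_
    all_goals
      intro l hl hl1 i hli hin
      by_cases hil : i = l
      swap
      · first
        | exact ih (l + 1) (by omega) (by omega) i (by omega) hin
        | exact absurd hil (by omega)
      have hrest : ∀ i, l < i → i ≤ n → A i • h i ∈ N := by
        intro i h1 h2
        first
        | exact ih (l + 1) (by omega) (by omega) i (by omega) h2
        | exact absurd h1 (by omega)
      subst hil
      by_cases hAi : A i = 0
      · rw [hAi, zero_smul]; exact N.zero_mem
      have e := hO i hl1 hin _ hs
      rw [map_sum, ← Finset.add_sum_erase _ _ (show i ∈ Finset.range (n + 1) by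
        rw [Finset.mem_range]; omega)] at e
      have e2 : ∑ x ∈ (Finset.range (n + 1)).erase i, O i (A x • h x) ∈ N := by
        refine N.sum_mem fun x hx => ?_
        rw [Finset.mem_erase, Finset.mem_range] at hx
        rw [map_smul]
        by_cases hx0 : x = 0
        · subst hx0; exact N.smul_mem _ (h0 i hl1 hin)
        rw [hκ i x hl1 hin (by omega) (by omega)]
        by_cases hxi : x < i
        · rw [hκ0 i x hl1 hin (by omega) hxi, zero_smul, smul_zero]; exact N.zero_mem
        · rw [smul_comm]; exact N.smul_mem _ (hrest x (by omega) (by omega))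
      have e3 := (N.add_mem_iff_left e2).1 e
      rw [map_smul, hκ i i hl1 hin hl1 hin, smul_comm] at e3
      exact (N.smul_mem_iff (hκ1 i hl1 hin hAi)).1 e3
  have hall : ∀ i, 1 ≤ i → i ≤ n → A i • h i ∈ N := fun i h1 h2 =>
    key (n - 1) 1 (by omega) le_rfl i h1 h2
  rw [Finset.sum_range_succ'] at hs
  have e2 : ∑ k ∈ Finset.range n, A (k + 1) • h (k + 1) ∈ N :=
    N.sum_mem fun k hk => hall _ (by omega) (by rw [Finset.mem_range] at hk; omega)
  have e3 := (N.add_mem_iff_right e2).1 hs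
  exact (N.smul_mem_iff hA).1 e3

section six
variable {p t : ℕ} [hp : Fact p.Prime]

local notation "𝕂" => GaloisField p t
local notation "𝕍" => SympV p t 3

lemma gL1 (ht : t ≠ 0) (x y : 𝕂) (a l : ℕ) (hl : 1 ≤ l) (hl2 : l + 1 < p ^ t) (ha : a ≤ p ^ t - 1) :
    ∑ c : 𝕂, c ^ (p ^ t - 1 - l) * (x + c * y) ^ a = -((a.choose l : 𝕂) * x ^ (a - l) * y ^ l) := by
  have := L1 x y a l hl (by rwa [cardK ht]) (by rwa [cardK ht])
  rwa [cardK ht] at this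

lemma gL2 (ht : t ≠ 0) (n : ℕ) (hn : 2 * n + 1 = p ^ t) (x y z w : 𝕂) :
    ∑ c : 𝕂, c ^ (p ^ t - 1 - n) * ((x + c * y) ^ n * (z + c * w) ^ (p ^ t - 1)) =
     -(∑ i ∈ Finset.range (n + 1), (n.choose i : 𝕂) * ((p ^ t - 1).choose i : 𝕂) *
        (x ^ i * y ^ (n - i) * z ^ (p ^ t - 1 - i) * w ^ i) + y ^ n * w ^ (p ^ t - 1)) := by
  have := L2 n (by rwa [cardK ht]) x y z w
  rwa [cardK ht] at this

lemma cast_ne {a : ℕ} (h : ¬ p ∣ a) : (a : 𝕂) ≠ 0 := by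
  rwa [Ne, CharP.cast_eq_zero_iff 𝕂 p]

lemma cast_ne' {a : ℕ} (h : (a : 𝕂) ≠ 0) : ¬ p ∣ a := by
  rwa [Ne, CharP.cast_eq_zero_iff 𝕂 p] at h

lemma extr_mem {V : Type*} (M : Submodule 𝕂 (V → 𝕂)) (k : ℕ) (F : 𝕂 → V → 𝕂)
    (h : ∀ c, F c ∈ M) : (fun v => ∑ c : 𝕂, c ^ k * F c v) ∈ M := by
  have : (fun v => ∑ c : 𝕂, c ^ k * F c v) = ∑ c : 𝕂, c ^ k • F c := by
    ext v; simp
  rw [this]; exact M.sum_mem fun c _ => M.smul_mem _ (h c)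

lemma smul_mem_fun {V : Type*} (M : Submodule 𝕂 (V → 𝕂)) (a : 𝕂) (ha : a ≠ 0) (f : V → 𝕂)
    (h : (fun v => a * f v) ∈ M) : f ∈ M := by
  have : (fun v => a * f v) = a • f := by ext v; simp
  rw [this] at h
  exact (M.smul_mem_iff ha).1 h

/-- extraction operator -/
def Dop {V : Type*} (T : 𝕂 → V → V) (k : ℕ) : (V → 𝕂) →ₗ[𝕂] (V → 𝕂) where
  toFun f := fun v => - ∑ c : 𝕂, c ^ k * f (T c v)
  map_add' f g := by
    ext v; simp only [Pi.add_apply, mul_add, Finset.sum_add_distrib]; ring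
  map_smul' a f := by
    ext v; simp only [Pi.smul_apply, smul_eq_mul, RingHom.id_apply, mul_neg, Finset.mul_sum]
    congr 1; exact Finset.sum_congr rfl fun c _ => by ring

lemma Dop_mem {V : Type*} (M : Submodule 𝕂 (V → 𝕂)) (T : 𝕂 → V → V) (k : ℕ)
    (hT : ∀ c, ∀ f ∈ M, (fun v => f (T c v)) ∈ M) (f : V → 𝕂) (hf : f ∈ M) : Dop T k f ∈ M :=
  M.neg_mem (extr_mem M k (fun c v => f (T c v)) fun c => hT c f hf)

def Tx (i : Fin 3) (c : 𝕂) (v : 𝕍) : 𝕍 := (Function.update v.1 i (v.1 i + c * v.2 i), v.2)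
def Ty (i : Fin 3) (c : 𝕂) (v : 𝕍) : 𝕍 := (v.1, Function.update v.2 i (v.2 i + c * v.1 i))
/-- `x_i += c y_j`, `x_j += c y_i` -/
def Txy (i j : Fin 3) (c : 𝕂) (v : 𝕍) : 𝕍 :=
  (Function.update (Function.update v.1 i (v.1 i + c * v.2 j)) j (v.1 j + c * v.2 i), v.2)
/-- `y_i += c y_j`, `x_j -= c x_i` -/
def Tyx (i j : Fin 3) (c : 𝕂) (v : 𝕍) : 𝕍 :=
  (Function.update v.1 j (v.1 j - c * v.1 i), Function.update v.2 i (v.2 i + c * v.2 j))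

def Stab (M : Submodule 𝕂 (𝕍 → 𝕂)) : Prop :=
  ∀ g g' : 𝕍 → 𝕍, (∀ v w, sform (g v) w = sform v (g' w)) →
    (∀ u w, sform (g' u) (g' w) = sform u w) → ∀ f ∈ M, (fun v => f (g v)) ∈ M

lemma stab_Tx {M : Submodule 𝕂 (𝕍 → 𝕂)} (h : Stab M) (i : Fin 3) (c : 𝕂) (f) (hf : f ∈ M) :
    (fun v => f (Tx i c v)) ∈ M := by
  refine h _ (Tx i (-c)) ?_ ?_ f hf <;> intro v w <;> fin_cases i <;>
    simp [sform, Fin.sum_univ_three, Tx] <;> ring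
lemma stab_Ty {M : Submodule 𝕂 (𝕍 → 𝕂)} (h : Stab M) (i : Fin 3) (c : 𝕂) (f) (hf : f ∈ M) :
    (fun v => f (Ty i c v)) ∈ M := by
  refine h _ (Ty i (-c)) ?_ ?_ f hf <;> intro v w <;> fin_cases i <;>
    simp [sform, Fin.sum_univ_three, Ty] <;> ring
lemma stab_Txy {M : Submodule 𝕂 (𝕍 → 𝕂)} (h : Stab M) (i j : Fin 3) (hij : i ≠ j) (c : 𝕂) (f)
    (hf : f ∈ M) : (fun v => f (Txy i j c v)) ∈ M := by
  refine h _ (Txy i j (-c)) ?_ ?_ f hf <;> intro v w <;> fin_cases i <;> fin_cases j <;>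
    simp [sform, Fin.sum_univ_three, Txy] at hij ⊢ <;> ring
lemma stab_Tyx {M : Submodule 𝕂 (𝕍 → 𝕂)} (h : Stab M) (i j : Fin 3) (hij : i ≠ j) (c : 𝕂) (f)
    (hf : f ∈ M) : (fun v => f (Tyx i j c v)) ∈ M := by
  refine h _ (Tyx i j (-c)) ?_ ?_ f hf <;> intro v w <;> fin_cases i <;> fin_cases j <;>
    simp [sform, Fin.sum_univ_three, Tyx] at hij ⊢ <;> ring

lemma DX (ht : t ≠ 0) (i : Fin 3) (g : 𝕍 → 𝕂) (hg : ∀ c v, g (Tx i c v) = g v) (a b l : ℕ)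
    (hl : 1 ≤ l) (hl2 : l + 1 < p ^ t) (ha : a ≤ p ^ t - 1) :
    Dop (Tx i) (p ^ t - 1 - l) (fun v => g v * (v.1 i ^ a * v.2 i ^ b)) =
      (a.choose l : 𝕂) • fun v => g v * (v.1 i ^ (a - l) * v.2 i ^ (b + l)) := by
  ext v
  simp only [Dop, LinearMap.coe_mk, AddHom.coe_mk, hg, Pi.smul_apply, smul_eq_mul]
  have : ∀ c : 𝕂, c ^ (p ^ t - 1 - l) * (g v * ((Tx i c v).1 i ^ a * (Tx i c v).2 i ^ b)) =
      g v * v.2 i ^ b * (c ^ (p ^ t - 1 - l) * (v.1 i + c * v.2 i) ^ a) := by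
    intro c; simp only [Tx, Function.update_self]; ring
  simp_rw [this]
  rw [← Finset.mul_sum, gL1 ht _ _ _ _ hl hl2 ha, pow_add]; ring

lemma DY (ht : t ≠ 0) (i : Fin 3) (g : 𝕍 → 𝕂) (hg : ∀ c v, g (Ty i c v) = g v) (a b l : ℕ)
    (hl : 1 ≤ l) (hl2 : l + 1 < p ^ t) (hb : b ≤ p ^ t - 1) :
    Dop (Ty i) (p ^ t - 1 - l) (fun v => g v * (v.1 i ^ a * v.2 i ^ b)) =
      (b.choose l : 𝕂) • fun v => g v * (v.1 i ^ (a + l) * v.2 i ^ (b - l)) := by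
  ext v
  simp only [Dop, LinearMap.coe_mk, AddHom.coe_mk, hg, Pi.smul_apply, smul_eq_mul]
  have : ∀ c : 𝕂, c ^ (p ^ t - 1 - l) * (g v * ((Ty i c v).1 i ^ a * (Ty i c v).2 i ^ b)) =
      g v * v.1 i ^ a * (c ^ (p ^ t - 1 - l) * (v.2 i + c * v.1 i) ^ b) := by
    intro c; simp only [Ty, Function.update_self]; ring
  simp_rw [this]
  rw [← Finset.mul_sum, gL1 ht _ _ _ _ hl hl2 hb, pow_add]; ring

/-- the composite operator in a pair -/
def Oop (p t : ℕ) [Fact p.Prime] (i : Fin 3) (l : ℕ) :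
    (SympV p t 3 → GaloisField p t) →ₗ[GaloisField p t] (SympV p t 3 → GaloisField p t) :=
  (Dop (Ty i) (p ^ t - 1 - l)) ∘ₗ (Dop (Tx i) (p ^ t - 1 - l))

lemma Oop_mem {M : Submodule 𝕂 (𝕍 → 𝕂)} (h : Stab M) (i : Fin 3) (l : ℕ) (f) (hf : f ∈ M) :
    Oop p t i l f ∈ M :=
  Dop_mem M _ _ (stab_Ty h i) _ (Dop_mem M _ _ (stab_Tx h i) f hf)

lemma Oop_eq (ht : t ≠ 0) (i : Fin 3) (g : 𝕍 → 𝕂) (hx : ∀ c v, g (Tx i c v) = g v)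
    (hy : ∀ c v, g (Ty i c v) = g v) (a l : ℕ)
    (hl : 1 ≤ l) (hl2 : l + 1 < p ^ t) (ha : a + l ≤ p ^ t - 1) :
    Oop p t i l (fun v => g v * (v.1 i * v.2 i) ^ a) =
      ((a.choose l : 𝕂) * ((a + l).choose l : 𝕂)) • fun v => g v * (v.1 i * v.2 i) ^ a := by
  simp_rw [mul_pow]
  rw [Oop, LinearMap.comp_apply, DX ht i g hx a a l hl hl2 (by omega), map_smul,
    DY ht i g hy _ _ l hl hl2 ha, smul_smul]
  by_cases h : l ≤ a
  · rw [Nat.sub_add_cancel h, Nat.add_sub_cancel]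
  · rw [Nat.choose_eq_zero_of_lt (by omega)]; simp

lemma Oop_eq_top (ht : t ≠ 0) (i : Fin 3) (g : 𝕍 → 𝕂) (hx : ∀ c v, g (Tx i c v) = g v)
    (hy : ∀ c v, g (Ty i c v) = g v) (k l : ℕ)
    (hl : 1 ≤ l) (hl2 : l + 1 < p ^ t) (hk : k < l) (hkl : k + l ≤ p ^ t - 1) :
    Oop p t i l (fun v => g v * (v.1 i * v.2 i) ^ (p ^ t - 1 - k)) =
      (((p ^ t - 1 - k).choose l : 𝕂) * ((l - k).choose l : 𝕂)) •
        fun v => g v * (v.1 i ^ (p ^ t - 1 - k) * v.2 i ^ (l - k - l)) := by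
  simp_rw [mul_pow]
  rw [Oop, LinearMap.comp_apply, DX ht i g hx _ _ l hl hl2 (by omega), map_smul]
  have : ∀ v : 𝕍, v.2 i ^ (p ^ t - 1 - k + l) = v.2 i ^ (l - k) := by
    intro v
    rw [pow_card_sub _ _ (by rw [cardK ht]; omega), cardK ht]
    congr 1; omega
  simp_rw [this]
  rw [DY ht i g hy _ _ l hl hl2 (by omega), smul_smul, Nat.sub_add_cancel (by omega)]

lemma iso_bot (ht : t ≠ 0) (n : ℕ) (hn : 2 * n + 1 = p ^ t) (hn1 : 1 ≤ n) (hp2 : p ≠ 2)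
    {M : Submodule 𝕂 (𝕍 → 𝕂)} (hM : Stab M) (i : Fin 3) (β : ℕ → 𝕂) (hβ : β 0 ≠ 0)
    (g : ℕ → 𝕍 → 𝕂) (hx : ∀ k c v, g k (Tx i c v) = g k v) (hy : ∀ k c v, g k (Ty i c v) = g k v)
    (hs : (fun v => ∑ k ∈ Finset.range (n + 1),
      (n.choose k : 𝕂) * β k * (g k v * (v.1 i * v.2 i) ^ k)) ∈ M) : g 0 ∈ M := by
  have := isolation M n (fun k => (n.choose k : 𝕂) * β k) (fun k v => g k v * (v.1 i * v.2 i) ^ k)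
    (by simpa using hβ)
    (by convert hs using 1; ext v; simp)
    (Oop p t i) (fun l _ _ f hf => Oop_mem hM i l f hf)
    (fun l k => (k.choose l : 𝕂) * ((k + l).choose l : 𝕂))
    (fun l k h1 h2 h3 h4 => Oop_eq ht i (g k) (hx k) (hy k) k l h1 (by omega) (by omega))
    (fun l k h1 h2 h3 h4 => by simp [Nat.choose_eq_zero_of_lt h4])
    (fun l h1 h2 h3 => by
      have h4 := choose_bot_ndvd t n l hp2 hn h2 (cast_ne' (left_ne_zero_of_mul h3))
      simpa using cast_ne (t := t) h4)
    (fun l h1 h2 => by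
      rw [Oop_eq ht i (g 0) (hx 0) (hy 0) 0 l h1 (by omega) (by omega),
        Nat.choose_eq_zero_of_lt (by omega)]
      simp)
  simpa using this

lemma iso_top (ht : t ≠ 0) (n : ℕ) (hn : 2 * n + 1 = p ^ t) (hn1 : 1 ≤ n) (hp2 : p ≠ 2)
    {M : Submodule 𝕂 (𝕍 → 𝕂)} (hM : Stab M) (i : Fin 3) (β : ℕ → 𝕂) (hβ : β 0 ≠ 0)
    (g : ℕ → 𝕍 → 𝕂) (hx : ∀ k c v, g k (Tx i c v) = g k v) (hy : ∀ k c v, g k (Ty i c v) = g k v)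
    (hs : (fun v => ∑ k ∈ Finset.range (n + 1),
      (n.choose k : 𝕂) * β k * (g k v * (v.1 i * v.2 i) ^ (p ^ t - 1 - k))) ∈ M)
    (h0 : (fun v => g 0 v * v.1 i ^ (p ^ t - 1)) ∈ M) :
    (fun v => g 0 v * (v.1 i * v.2 i) ^ (p ^ t - 1)) ∈ M := by
  have := isolation M n (fun k => (n.choose k : 𝕂) * β k)
    (fun k v => g k v * (v.1 i * v.2 i) ^ (p ^ t - 1 - k))
    (by simpa using hβ)
    (by convert hs using 1; ext v; simp)
    (Oop p t i) (fun l _ _ f hf => Oop_mem hM i l f hf)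
    (fun l k => if k < l then 0 else
      ((p ^ t - 1 - k).choose l : 𝕂) * ((p ^ t - 1 - k + l).choose l : 𝕂))
    (fun l k h1 h2 h3 h4 => by
      split_ifs with h
      · rw [Oop_eq_top ht i (g k) (hx k) (hy k) k l h1 (by omega) h (by omega),
          Nat.choose_eq_zero_of_lt (show l - k < l by omega)]; simp
      · exact Oop_eq ht i (g k) (hx k) (hy k) _ l h1 (by omega) (by omega))
    (fun l k h1 h2 h3 h4 => by simp [h4])
    (fun l h1 h2 h3 => by
      have h4 := choose_mid_ndvd t n l hp2 hn h2 (cast_ne' (left_ne_zero_of_mul h3))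
      have h5 := choose_top_ndvd (p := p) t l (by omega)
      simp only [lt_irrefl, if_false]
      rw [show p ^ t - 1 - l + l = p ^ t - 1 by omega]
      exact mul_ne_zero (cast_ne h4) (cast_ne h5))
    (fun l h1 h2 => by
      rw [Oop_eq_top ht i (g 0) (hx 0) (hy 0) 0 l h1 (by omega) (by omega) (by omega)]
      apply M.smul_mem
      simpa using h0)
  simpa using this

end six
end IE

namespace IE
section cores
variable {p t : ℕ} [hp : Fact p.Prime]

local notation "𝕂" => GaloisField p t
local notation "𝕍" => SympV p t 3

/-- extraction of the middle coefficient in a single power -/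
lemma extr1 (ht : t ≠ 0) (n : ℕ) (hn : 2 * n + 1 = p ^ t) (hn1 : 1 ≤ n)
    (M : Submodule 𝕂 (𝕍 → 𝕂)) (g x y : 𝕍 → 𝕂)
    (h : ∀ c : 𝕂, (fun v => g v * (x v + c * y v) ^ (p ^ t - 1)) ∈ M) :
    (fun v => g v * (x v ^ n * y v ^ n)) ∈ M := by
  have h1 := extr_mem M (p ^ t - 1 - n) _ h
  apply smul_mem_fun M (-((p ^ t - 1).choose n : 𝕂))
    (neg_ne_zero.2 (cast_ne (choose_top_ndvd t n (by omega))))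
  convert h1 using 1
  ext v
  have : ∀ c : 𝕂, c ^ (p ^ t - 1 - n) * (g v * (x v + c * y v) ^ (p ^ t - 1)) =
      g v * (c ^ (p ^ t - 1 - n) * (x v + c * y v) ^ (p ^ t - 1)) := fun c => by ring
  simp_rw [this]
  rw [← Finset.mul_sum, gL1 ht _ _ _ _ hn1 (by omega) le_rfl,
    show p ^ t - 1 - n = n by omega]; ring

lemma extr2 (ht : t ≠ 0) (n : ℕ) (hn : 2 * n + 1 = p ^ t)
    (M : Submodule 𝕂 (𝕍 → 𝕂)) (g x y z w : 𝕍 → 𝕂)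
    (h : ∀ c : 𝕂, (fun v => g v * ((x v + c * y v) ^ n * (z v + c * w v) ^ (p ^ t - 1))) ∈ M)
    (hw : (fun v => g v * (y v ^ n * w v ^ (p ^ t - 1))) ∈ M) :
    (fun v => ∑ i ∈ Finset.range (n + 1), (n.choose i : 𝕂) * ((p ^ t - 1).choose i : 𝕂) *
        (g v * (x v ^ i * y v ^ (n - i) * z v ^ (p ^ t - 1 - i) * w v ^ i))) ∈ M := by
  have h1 := extr_mem M (p ^ t - 1 - n) _ h
  have h2 := M.neg_mem (M.add_mem h1 hw)
  convert h2 using 1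
  ext v
  simp only [Pi.neg_apply, Pi.add_apply]
  have : ∀ c : 𝕂, c ^ (p ^ t - 1 - n) * (g v * ((x v + c * y v) ^ n * (z v + c * w v) ^ (p ^ t - 1))) =
      g v * (c ^ (p ^ t - 1 - n) * ((x v + c * y v) ^ n * (z v + c * w v) ^ (p ^ t - 1))) :=
    fun c => by ring
  simp_rw [this]
  rw [← Finset.mul_sum, gL2 ht n hn]
  simp only [mul_neg, mul_add, neg_add, neg_neg, Finset.mul_sum]
  rw [add_assoc, add_neg_cancel, add_zero]
  exact Finset.sum_congr rfl fun i _ => by ring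

lemma coreB (ht : t ≠ 0) (hp2 : p ≠ 2) (n : ℕ) (hn : 2 * n + 1 = p ^ t) (hn1 : 1 ≤ n)
    {M : Submodule 𝕂 (𝕍 → 𝕂)} (hM : Stab M)
    (hX : ∀ u w : 𝕍, sform u w = 0 → Xf u * Xf w ∈ M) :
    (fun v => (v.1 0 * v.2 0) ^ (p ^ t - 1)) ∈ M := by
  -- first step
  have a1 : ∀ c : 𝕂, (fun v : 𝕍 => v.2 2 ^ 0 * (v.1 2 ^ n *
      ((v.1 1 + c * v.2 0) ^ n * (v.1 0 + c * v.2 1) ^ (p ^ t - 1)))) ∈ M := by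
    intro c
    have := extr1 ht n hn hn1 M (fun v : 𝕍 => (v.1 0 + c * v.2 1) ^ (p ^ t - 1))
      (fun v => v.1 1 + c * v.2 0) (fun v => v.1 2) (by
        intro e
        convert hX (![0, -c, 0], ![1, 0, 0]) (![-c, 0, 0], ![0, 1, e])
          (by simp [sform, Fin.sum_univ_three]) using 1
        ext v
        simp only [Xf, Pi.mul_apply, sform, Fin.sum_univ_three]
        congr 2 <;> simp <;> ring)
    convert this using 1
    ext v; ring
  have a2 : (fun v : 𝕍 => v.1 2 ^ n * (v.2 0 ^ n * v.2 1 ^ (p ^ t - 1))) ∈ M := by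
    have := extr1 ht n hn hn1 M (fun v : 𝕍 => (v.2 1) ^ (p ^ t - 1))
      (fun v => v.2 0) (fun v => v.1 2) (by
        intro e
        convert hX (![0, -1, 0], ![0, 0, 0]) (![-1, 0, 0], ![0, 0, e])
          (by simp [sform, Fin.sum_univ_three]) using 1
        ext v
        simp only [Xf, Pi.mul_apply, sform, Fin.sum_univ_three]
        congr 2 <;> simp <;> ring)
    convert this using 1
    ext v; ring
  have a3 := extr2 ht n hn M (fun v : 𝕍 => v.1 2 ^ n) (fun v => v.1 1) (fun v => v.2 0)
    (fun v => v.1 0) (fun v => v.2 1) (by simpa using a1) a2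
  have a4 := iso_bot ht n hn hn1 hp2 hM 1 (fun k => ((p ^ t - 1).choose k : 𝕂)) (by simp)
    (fun k v => v.1 2 ^ n * v.2 0 ^ (n - k) * v.1 0 ^ (p ^ t - 1 - k))
    (by intro k c v; simp [Tx]) (by intro k c v; simp [Ty]) (by
      convert a3 using 1
      ext v
      exact Finset.sum_congr rfl fun k _ => by rw [mul_pow]; ring)
  simp only [Nat.sub_zero] at a4
  -- second step
  have b1 := extr2 ht n hn M (fun v : 𝕍 => v.2 0 ^ n) (fun v => v.1 2) (fun v => v.2 0)
    (fun v => v.1 0) (fun v => v.2 2) (by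
      intro c
      convert stab_Txy hM 0 2 (by decide) c _ a4 using 1
      ext v; simp [Txy]; ring) (by
      convert hX (![-1, 0, 0], ![0, 0, 0]) (![0, 0, -1], ![0, 0, 0])
          (by simp [sform, Fin.sum_univ_three]) using 1
      ext v
      rw [← mul_assoc, ← pow_add, show n + n = p ^ t - 1 by omega]
      simp only [Xf, Pi.mul_apply, sform, Fin.sum_univ_three]
      congr 2 <;> simp)
  have b2 := iso_bot ht n hn hn1 hp2 hM 2 (fun k => ((p ^ t - 1).choose k : 𝕂)) (by simp)
    (fun k v => (v.1 0 * v.2 0) ^ (p ^ t - 1 - k))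
    (by intro k c v; simp [Tx]) (by intro k c v; simp [Ty]) (by
      convert b1 using 1
      ext v
      refine Finset.sum_congr rfl fun k hk => ?_
      rw [Finset.mem_range] at hk
      rw [mul_pow, mul_pow, show p ^ t - 1 - k = n + (n - k) by omega, pow_add (v.2 0)]; ring)
  simpa using b2

lemma coreA (ht : t ≠ 0) (hp2 : p ≠ 2) (n : ℕ) (hn : 2 * n + 1 = p ^ t) (hn1 : 1 ≤ n)
    {M : Submodule 𝕂 (𝕍 → 𝕂)} (hM : Stab M)
    (hX : ∀ u w a b : 𝕍, sform u w = 0 → sform u a = 0 → sform u b = 0 → sform w a = 0 →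
      sform w b = 0 → Xf u * Xf w * Xf a * Xf b ∈ M)
    (hE : ∀ u w a : 𝕍, Xf u * Xf w * Xf a ∈ M) :
    (fun v => (v.1 1 * v.2 1) ^ (p ^ t - 1) * (v.1 2 * v.2 2) ^ (p ^ t - 1)) ∈ M := by
  have a1 : ∀ c : 𝕂, (fun v : 𝕍 => (v.1 1 ^ (p ^ t - 1) * v.1 2 ^ (p ^ t - 1) * v.1 0 ^ (p ^ t - 1)) *
      (v.2 1 + c * v.2 2) ^ (p ^ t - 1)) ∈ M := by
    intro c
    have h1 := hX (![0, 0, 0], ![0, -c, 1]) (![0, 0, 0], ![1, 0, 0]) (![0, 0, 0], ![0, 1, 0])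
      (![0, -1, -c], ![0, 0, 0]) (by simp [sform, Fin.sum_univ_three])
      (by simp [sform, Fin.sum_univ_three]) (by simp [sform, Fin.sum_univ_three])
      (by simp [sform, Fin.sum_univ_three]) (by simp [sform, Fin.sum_univ_three])
    have h2 := hE (![0, 0, 0], ![0, -c, 1]) (![0, 0, 0], ![1, 0, 0]) (![0, -1, -c], ![0, 0, 0])
    have h3 := hE (![0, 0, 0], ![0, 0, 1]) (![0, 0, 0], ![1, 0, 0]) (![0, -1, -c], ![0, 0, 0])
    convert M.add_mem (M.sub_mem h1 h2) h3 using 1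
    ext v
    simp only [Xf, Pi.mul_apply, Pi.add_apply, Pi.sub_apply, sform, Fin.sum_univ_three]
    have key : (v.1 1 * -c + v.1 2) ^ (p ^ t - 1) * v.1 1 ^ (p ^ t - 1) =
        v.1 1 ^ (p ^ t - 1) * v.1 2 ^ (p ^ t - 1) + (v.1 1 * -c + v.1 2) ^ (p ^ t - 1) -
        v.1 2 ^ (p ^ t - 1) := by
      by_cases h : v.1 1 = 0
      · rw [h]; simp [pow_q1 ht]
      · rw [pow_q1 ht (v.1 1), if_neg h]; ring
    simp
    rw [show v.2 1 + v.2 2 * c = v.2 1 + c * v.2 2 by ring] at *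
    linear_combination (-(v.1 0 ^ (p ^ t - 1) * (v.2 1 + c * v.2 2) ^ (p ^ t - 1))) * key
  have a2 := extr1 ht n hn hn1 M _ _ _ a1
  have a3 := extr1 ht n hn hn1 M (fun v : 𝕍 => (v.1 1 ^ (p ^ t - 1) * v.2 1 ^ n) *
      (v.1 2 ^ (p ^ t - 1) * v.2 2 ^ n)) (fun v => v.1 0) (fun v => v.2 0) (by
      intro c
      convert stab_Tx hM 0 c _ a2 using 1
      ext v; simp [Tx]; ring)
  have e1 : ∀ f : 𝕍 → 𝕂, (∃ u : 𝕍, f = Xf u) → 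
      (fun v : 𝕍 => f v * (v.2 0 ^ n * v.2 2 ^ n * v.1 2 ^ (p ^ t - 1))) ∈ M := by
    rintro f ⟨u, rfl⟩
    have := extr1 ht n hn hn1 M (fun v : 𝕍 => Xf u v * v.1 2 ^ (p ^ t - 1))
      (fun v => v.2 0) (fun v => v.2 2) (by
        intro e
        convert hE u (![0, 0, 0], ![0, 0, 1]) (![-1, 0, -e], ![0, 0, 0]) using 1
        ext v
        simp only [Xf, Pi.mul_apply, sform, Fin.sum_univ_three]
        congr 2 <;> simp <;> ring)
    convert this using 1
    ext v; ring
  have y1 : (fun v : 𝕍 => v.2 1 ^ (p ^ t - 1)) = Xf (![0, -1, 0], ![0, 0, 0]) := by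
    ext v; simp [Xf, sform, Fin.sum_univ_three]
  have x1 : (fun v : 𝕍 => v.1 1 ^ (p ^ t - 1)) = Xf (![0, 0, 0], ![0, 1, 0]) := by
    ext v; simp [Xf, sform, Fin.sum_univ_three]
  have y0n : ∀ v : 𝕍, v.2 0 ^ n * v.2 0 ^ (p ^ t - 1) = v.2 0 ^ n := by
    intro v
    rw [← pow_add, pow_card_sub _ _ (by rw [cardK ht]; omega), cardK ht]; congr 1; omega
  have b1 := extr2 ht n hn M (fun v : 𝕍 => v.2 1 ^ n * v.2 0 ^ n * (v.1 2 ^ (p ^ t - 1) * v.2 2 ^ n))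
    (fun v => v.1 0) (fun v => v.2 1) (fun v => v.1 1) (fun v => v.2 0) (by
      intro c
      convert stab_Txy hM 0 1 (by decide) c _ a3 using 1
      ext v; simp [Txy]; ring) (by
      convert e1 _ ⟨_, y1⟩ using 1
      ext v
      rw [show p ^ t - 1 = n + n by omega, pow_add (v.2 1), ← show p ^ t - 1 = n + n by omega]
      linear_combination (v.2 1 ^ n * v.2 1 ^ n * v.1 2 ^ (p ^ t - 1) * v.2 2 ^ n) * y0n v)
  have b2 := iso_top ht n hn hn1 hp2 hM 1 (fun k => ((p ^ t - 1).choose k : 𝕂)) (by simp)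
    (fun k v => (v.1 0 * v.2 0) ^ k * v.2 0 ^ n * (v.1 2 ^ (p ^ t - 1) * v.2 2 ^ n))
    (by intro k c v; simp [Tx]) (by intro k c v; simp [Ty]) (by
      convert b1 using 1
      ext v
      refine Finset.sum_congr rfl fun k hk => ?_
      rw [Finset.mem_range] at hk
      rw [mul_pow, mul_pow, show p ^ t - 1 - k = n + (n - k) by omega, pow_add (v.2 1)]; ring) (by
      convert e1 _ ⟨_, x1⟩ using 1
      ext v; simp only [pow_zero]; ring)
  simp only [pow_zero, one_mul] at b2
  have ev : Even (p ^ t - 1) := ⟨n, by omega⟩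
  have c1 := extr2 ht n hn M (fun v : 𝕍 => v.2 2 ^ n * (v.1 1 * v.2 1) ^ (p ^ t - 1))
    (fun v => v.2 0) (fun v => v.2 2) (fun v => v.1 2) (fun v => - v.1 0) (by
      intro c
      convert stab_Tyx hM 0 2 (by decide) c _ b2 using 1
      ext v; simp [Tyx]; ring) (by
      have h1 := hX (![0, 0, -1], ![0, 0, 0]) (![0, 0, 0], ![1, 0, 0]) (![0, 0, 0], ![0, 1, 0])
        (![0, -1, 0], ![0, 0, 0]) (by simp [sform, Fin.sum_univ_three])
        (by simp [sform, Fin.sum_univ_three]) (by simp [sform, Fin.sum_univ_three])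
        (by simp [sform, Fin.sum_univ_three]) (by simp [sform, Fin.sum_univ_three])
      convert h1 using 1
      ext v
      simp only [Xf, Pi.mul_apply, sform, Fin.sum_univ_three]
      simp
      rw [ev.neg_pow, mul_pow]
      rw [show v.2 2 ^ (p ^ t - 1) = v.2 2 ^ n * v.2 2 ^ n by rw [← pow_add]; congr 1; omega]
      ring)
  have c2 := iso_bot ht n hn hn1 hp2 hM 0 (fun k => ((p ^ t - 1).choose k : 𝕂) * (-1) ^ k) (by simp)
    (fun k v => (v.1 1 * v.2 1) ^ (p ^ t - 1) * (v.1 2 * v.2 2) ^ (p ^ t - 1 - k))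
    (by intro k c v; simp [Tx]) (by intro k c v; simp [Ty]) (by
      convert c1 using 1
      ext v
      refine Finset.sum_congr rfl fun k hk => ?_
      rw [Finset.mem_range] at hk
      rw [mul_pow (v.1 0), mul_pow (v.1 2), neg_pow (v.1 0),
        show p ^ t - 1 - k = n + (n - k) by omega, pow_add (v.2 2)]; ring)
  simpa using c2

end cores
end IE

namespace IE
section totiso
variable {p t m : ℕ} [hp : Fact p.Prime]
local notation "𝕂" => GaloisField p t
local notation "𝕍" => SympV p t m

lemma totIso_iff {W : Submodule 𝕂 𝕍} : IsTotIso W ↔ W ≤ sperp W :=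
  ⟨fun h u hu => mem_sperp.2 fun w hw => h u hu w hw, fun h u hu w hw => mem_sperp.1 (h hu) w hw⟩

lemma totIso_sup_span {T : Submodule 𝕂 𝕍} (h : IsTotIso T) {s : 𝕍} (hs : s ∈ sperp T) :
    IsTotIso (T ⊔ Submodule.span 𝕂 {s}) := by
  intro u hu w hw
  obtain ⟨a, ha, b, hb, rfl⟩ := Submodule.mem_sup.1 hu
  obtain ⟨a', ha', b', hb', rfl⟩ := Submodule.mem_sup.1 hw
  obtain ⟨c, rfl⟩ := Submodule.mem_span_singleton.1 hb
  obtain ⟨c', rfl⟩ := Submodule.mem_span_singleton.1 hb'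
  simp only [sform_add_left, sform_add_right, sform_smul_left, sform_smul_right, sform_self,
    h a ha a' ha', mem_sperp.1 hs a' ha', sform_comm_zero (mem_sperp.1 hs a ha)]
  ring

lemma sperp_bot : sperp (⊥ : Submodule 𝕂 𝕍) = ⊤ := by
  rw [eq_top_iff]; intro v _; rw [mem_sperp]; intro w hw
  rw [(Submodule.mem_bot 𝕂).1 hw, sform_zero_right]

lemma totIso_bot : IsTotIso (⊥ : Submodule 𝕂 𝕍) := by
  rw [totIso_iff]; exact bot_le

lemma totIso_span (u : 𝕍) : IsTotIso (Submodule.span 𝕂 {u}) := by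
  have := totIso_sup_span (T := ⊥) totIso_bot (s := u) (by rw [sperp_bot]; trivial)
  rwa [bot_sup_eq] at this

lemma finrank_span1 (u : 𝕍) : Module.finrank 𝕂 (Submodule.span 𝕂 {u} : Submodule 𝕂 𝕍) ≤ 1 := by
  have := finrank_sup_span_le (⊥ : Submodule 𝕂 𝕍) u
  rw [bot_sup_eq, finrank_bot] at this; omega

end totiso

section six
variable {p t : ℕ} [hp : Fact p.Prime]
local notation "𝕂" => GaloisField p t
local notation "𝕍" => SympV p t 3

lemma Xf_comp (g g' : 𝕍 → 𝕍) (h : ∀ v w, sform (g v) w = sform v (g' w)) (u v : 𝕍) :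
    Xf u (g v) = Xf (g' u) v := by simp only [Xf, h]

def MB (p t : ℕ) [Fact p.Prime] : Submodule (GaloisField p t) (SympV p t 3 → GaloisField p t) :=
  Submodule.span _ {f | ∃ u w, sform u w = 0 ∧ f = Xf u * Xf w}

lemma MB_stab : Stab (MB p t) := by
  intro g g' h1 h2 f hf
  have : MB p t ≤ (MB p t).comap (LinearMap.funLeft 𝕂 𝕂 g) := by
    rw [MB, Submodule.span_le]
    rintro f ⟨u, w, huw, rfl⟩
    refine Submodule.subset_span ⟨g' u, g' w, by rw [h2, huw], ?_⟩
    ext v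
    simp [LinearMap.funLeft, Xf_comp g g' h1]
  exact this hf

def MA (p t : ℕ) [Fact p.Prime] : Submodule (GaloisField p t) (SympV p t 3 → GaloisField p t) :=
  Submodule.span _ ({f | ∃ u w a b : SympV p t 3, sform u w = 0 ∧ sform u a = 0 ∧ sform u b = 0 ∧
    sform w a = 0 ∧ sform w b = 0 ∧ f = Xf u * Xf w * Xf a * Xf b} ∪
    {f | ∃ u w a : SympV p t 3, f = Xf u * Xf w * Xf a})

lemma MA_stab : Stab (MA p t) := by
  intro g g' h1 h2 f hf
  have : MA p t ≤ (MA p t).comap (LinearMap.funLeft 𝕂 𝕂 g) := by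
    rw [MA, Submodule.span_le]
    rintro f (⟨u, w, a, b, e1, e2, e3, e4, e5, rfl⟩ | ⟨u, w, a, rfl⟩)
    · refine Submodule.subset_span (Or.inl ⟨g' u, g' w, g' a, g' b, by rw [h2, e1], by rw [h2, e2],
        by rw [h2, e3], by rw [h2, e4], by rw [h2, e5], ?_⟩)
      ext v
      simp [LinearMap.funLeft, Xf_comp g g' h1]
    · refine Submodule.subset_span (Or.inr ⟨g' u, g' w, g' a, ?_⟩)
      ext v
      simp [LinearMap.funLeft, Xf_comp g g' h1]
  exact this hf

lemma exists_n (ht : t ≠ 0) (hp2 : p ≠ 2) : ∃ n, 2 * n + 1 = p ^ t ∧ 1 ≤ n := by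
  have h1 : Odd (p ^ t) := (hp.out.odd_of_ne_two hp2).pow
  obtain ⟨n, hn⟩ := h1
  have := Nat.one_lt_pow ht hp.out.one_lt
  exact ⟨n, hn.symm, by omega⟩

lemma y_eq (i : Fin 3) : (fun v : 𝕍 => v.2 i ^ (p ^ t - 1)) = Xf (-Pi.single i 1, 0) := by
  ext v; fin_cases i <;> simp [Xf, sform, Fin.sum_univ_three]
lemma x_eq (i : Fin 3) : (fun v : 𝕍 => v.1 i ^ (p ^ t - 1)) = Xf (0, Pi.single i 1) := by
  ext v; fin_cases i <;> simp [Xf, sform, Fin.sum_univ_three]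

lemma B6 (ht : t ≠ 0) (hp2 : p ≠ 2) (N : Submodule 𝕂 (𝕍 → 𝕂))
    (h : ∀ L : Submodule 𝕂 𝕍, IsTotIso L → Module.finrank 𝕂 L = 2 → ind (sperp L) ∈ N) :
    (fun v : 𝕍 => if v.1 0 = 0 ∧ v.2 0 = 0 then (1 : 𝕂) else 0) ∈ N := by
  have h2 : ∀ k (T : Submodule 𝕂 𝕍), IsTotIso T → Module.finrank 𝕂 T + k = 2 → ind (sperp T) ∈ N := by
    intro k
    induction k with
    | zero => intro T hT hd; exact h T hT (by simpa using hd)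
    | succ k ih =>
      intro T hT hd
      have hf := finrank_sperp T
      apply LSgen ht N (sperp T) (sperp T)
      · rw [sperp_sperp]; omega
      · intro s hs hs'
        rw [sperp_sperp] at hs'
        rw [← sperp_span, ← sperp_sup]
        exact ih _ (totIso_sup_span hT hs) (by rw [finrank_sup_span hs']; omega)
  have h3 : ∀ (T : Submodule 𝕂 𝕍), IsTotIso T → Module.finrank 𝕂 T ≤ 2 → ind (sperp T) ∈ N :=
    fun T hT hd => h2 (2 - Module.finrank 𝕂 T) T hT (by omega)
  have one : (1 : 𝕍 → 𝕂) ∈ N := by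
    have := h3 ⊥ totIso_bot (by rw [finrank_bot]; omega)
    rwa [sperp_bot, ind_top] at this
  have hy : ∀ u : 𝕍, ind (hyp u) ∈ N := by
    intro u
    have := h3 _ (totIso_span u) ((finrank_span1 u).trans (by omega))
    rwa [sperp_span] at this
  have hX1 : ∀ u : 𝕍, Xf u ∈ N := fun u => by
    rw [X_eq ht]; exact N.sub_mem one (hy u)
  have hle : MB p t ≤ N := by
    rw [MB, Submodule.span_le]
    rintro f ⟨u, w, huw, rfl⟩
    have := h3 (Submodule.span 𝕂 {u} ⊔ Submodule.span 𝕂 {w})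
      (totIso_sup_span (totIso_span u) (by rw [sperp_span, mem_hyp]; exact sform_comm_zero huw))
      (by have h1 := finrank_sup_span_le (Submodule.span 𝕂 {u}) w
          have h2 := finrank_span1 u
          omega)
    rw [sperp_sup, sperp_span, sperp_span] at this
    have e : Xf u * Xf w = 1 - ind (hyp u) - ind (hyp w) + ind (hyp u ⊓ hyp w) := by
      rw [ind_inf_hyp ht, X_eq ht u, X_eq ht w]; ring
    rw [e]
    exact N.add_mem (N.sub_mem (N.sub_mem one (hy u)) (hy w)) this
  obtain ⟨n, hn, hn1⟩ := exists_n (p := p) ht hp2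
  have hc := hle (coreB ht hp2 n hn hn1 MB_stab fun u w huw => Submodule.subset_span ⟨u, w, huw, rfl⟩)
  have hx := hX1 (0, Pi.single 0 1)
  have hy := hX1 (-Pi.single 0 1, 0)
  rw [← x_eq] at hx
  rw [← y_eq] at hy
  convert N.add_mem (N.sub_mem (N.sub_mem one hx) hy) hc using 1
  ext v
  simp only [Pi.add_apply, Pi.sub_apply, Pi.one_apply, mul_pow, pow_q1 ht]
  split_ifs <;> simp_all

lemma four_mem (N : Submodule 𝕂 (𝕍 → 𝕂)) (one : (1 : 𝕍 → 𝕂) ∈ N)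
    (hE : ∀ l : List 𝕍, l.length ≤ 3 → (l.map Xf).prod ∈ N) (X1 X2 Y1 Y2 : 𝕍)
    (hc : Xf X1 * Xf X2 * Xf Y1 * Xf Y2 ∈ N) :
    (1 - Xf X1) * (1 - Xf X2) * (1 - Xf Y1) * (1 - Xf Y2) ∈ N := by
  have g1 := hE [X1] (by simp)
  have g2 := hE [X2] (by simp)
  have g3 := hE [Y1] (by simp)
  have g4 := hE [Y2] (by simp)
  have g12 := hE [X1, X2] (by simp)
  have g13 := hE [X1, Y1] (by simp)
  have g14 := hE [X1, Y2] (by simp)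
  have g23 := hE [X2, Y1] (by simp)
  have g24 := hE [X2, Y2] (by simp)
  have g34 := hE [Y1, Y2] (by simp)
  have g123 := hE [X1, X2, Y1] (by simp)
  have g124 := hE [X1, X2, Y2] (by simp)
  have g134 := hE [X1, Y1, Y2] (by simp)
  have g234 := hE [X2, Y1, Y2] (by simp)
  simp only [List.map_cons, List.map_nil, List.prod_cons, List.prod_nil, mul_one] at *
  generalize Xf X1 = a, Xf X2 = b, Xf Y1 = c, Xf Y2 = d at *
  have : (1 - a) * (1 - b) * (1 - c) * (1 - d) =
      1 - a - b - c - d + a * b + a * c + a * d + b * c + b * d + c * d - a * (b * c) -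
      a * (b * d) - a * (c * d) - b * (c * d) + a * b * c * d := by ring
  rw [this]
  refine N.add_mem (N.sub_mem (N.sub_mem (N.sub_mem (N.sub_mem (N.add_mem (N.add_mem (N.add_mem
    (N.add_mem (N.add_mem (N.add_mem (N.sub_mem (N.sub_mem (N.sub_mem (N.sub_mem one g1) g2) g3) g4)
    g12) g13) g14) g23) g24) g34) g123) g124) g134) g234) hc

lemma A6 (ht : t ≠ 0) (hp2 : p ≠ 2) (N : Submodule 𝕂 (𝕍 → 𝕂))
    (h : ∀ L : Submodule 𝕂 𝕍, IsTotIso L → Module.finrank 𝕂 L = 2 → ind L ∈ N) :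
    (fun v : 𝕍 => if v.1 1 = 0 ∧ v.2 1 = 0 ∧ v.1 2 = 0 ∧ v.2 2 = 0 then (1 : 𝕂) else 0) ∈ N := by
  -- 3-dimensional subspaces
  have h3 : ∀ U : Submodule 𝕂 𝕍, Module.finrank 𝕂 U = 3 → ind U ∈ N := by
    intro U hU
    by_cases hT : IsTotIso U
    · apply LSgen ht N U ⊤
      · have := finrank_sperp U
        rw [finrank_top, finrankV]; omega
      · intro s _ hs
        have := finrank_inf_hyp hs
        exact h _ (fun a ha b hb => hT a ha.1 b hb.1) (by omega)
    · -- hyperbolic pair in `U`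
      simp only [IsTotIso] at hT; push Not at hT
      obtain ⟨a, ha, b, hb, hab⟩ := hT
      have hna : a ∉ sperp U := fun hc => hab (mem_sperp.1 hc b hb)
      have d1 := finrank_inf_hyp hna
      have d2 := finrank_inf_hyp_le (U ⊓ hyp a) b
      obtain ⟨z, hz, hz0⟩ := exists_not_mem_of_finrank_lt (A := ⊥) (B := U ⊓ hyp a ⊓ hyp b)
        (by rw [finrank_bot]; omega)
      obtain ⟨⟨hzU, hza⟩, hzb⟩ := hz
      replace hza : sform z a = 0 := hza
      replace hzb : sform z b = 0 := hzb
      have hbn : b ∉ Submodule.span 𝕂 {a} := by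
        intro hc
        obtain ⟨c, rfl⟩ := Submodule.mem_span_singleton.1 hc
        rw [sform_smul_right, sform_self, mul_zero] at hab; exact hab rfl
      have hane : a ≠ 0 := by rintro rfl; exact hab (sform_zero_left _)
      have hzn : z ∉ Submodule.span 𝕂 {a} ⊔ Submodule.span 𝕂 {b} := by
        intro hc
        obtain ⟨x, hx, y, hy, rfl⟩ := Submodule.mem_sup.1 hc
        obtain ⟨c, rfl⟩ := Submodule.mem_span_singleton.1 hx
        obtain ⟨c', rfl⟩ := Submodule.mem_span_singleton.1 hy
        simp only [sform_add_left, sform_smul_left, sform_self, mul_zero, zero_add, add_zero] at hza hzb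
        have e1 : c = 0 := (mul_eq_zero.1 hzb).resolve_right hab
        have e2 : c' = 0 := (mul_eq_zero.1 hza).resolve_right fun hc => hab (sform_comm_zero hc)
        subst e1 e2; simp at hz0
      have hUeq : U = Submodule.span 𝕂 {a} ⊔ Submodule.span 𝕂 {b} ⊔ Submodule.span 𝕂 {z} := by
        symm
        apply Submodule.eq_of_le_of_finrank_eq
        · refine sup_le (sup_le ?_ ?_) ?_ <;> simpa
        · rw [finrank_sup_span hzn, finrank_sup_span hbn, finrank_span_singleton hane, hU]
      have hzp : z ∈ sperp U := by
        rw [hUeq, sperp_sup, sperp_sup, sperp_span, sperp_span, sperp_span]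
        exact ⟨⟨hza, hzb⟩, sform_self z⟩
      have hz0' : z ≠ 0 := by rintro rfl; exact hz0 (Submodule.zero_mem _)
      apply LSgen ht N U (hyp z)
      · have e1 := finrank_sperp U
        have e2 := finrank_sperp (Submodule.span 𝕂 {z})
        rw [sperp_span, finrank_span_singleton hz0'] at e2
        omega
      · intro s hs hsn
        have d3 := finrank_inf_hyp hsn
        -- the plane contains `z`
        have hzP : z ∈ U ⊓ hyp s := ⟨hzU, mem_hyp.2 (sform_comm_zero hs)⟩
        obtain ⟨y, hy, hyz⟩ := exists_not_mem_of_finrank_lt (A := Submodule.span 𝕂 {z}) (B := U ⊓ hyp s)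
          (by rw [finrank_span_singleton hz0']; omega)
        have hPeq : Submodule.span 𝕂 {z} ⊔ Submodule.span 𝕂 {y} = U ⊓ hyp s := by
          apply Submodule.eq_of_le_of_finrank_eq
          · refine sup_le ?_ ?_
            · simpa using hzP
            · simpa using hy
          · rw [finrank_sup_span hyz, finrank_span_singleton hz0']; omega
        apply h
        · rw [← hPeq]
          apply totIso_sup_span (totIso_span z)
          rw [sperp_span, mem_hyp]
          exact sform_comm_zero (mem_sperp.1 hzp y hy.1)
        · omega
  have hge := ind_ge ht N 3 (by omega) h3
  have hT : Module.finrank 𝕂 (⊤ : Submodule 𝕂 𝕍) = 6 := by rw [finrank_top, finrankV]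
  have one : (1 : 𝕍 → 𝕂) ∈ N := by rw [← ind_top]; exact hge _ (by omega)
  have hE : ∀ l : List 𝕍, l.length ≤ 3 → (l.map Xf).prod ∈ N := by
    intro l hl
    have := prod_mem ht N 3 hge l ⊤ (by omega)
    rwa [ind_top, one_mul] at this
  have hle : MA p t ≤ N := by
    rw [MA, Submodule.span_le]
    rintro f (⟨u, w, a, b, e1, e2, e3, e4, e5, rfl⟩ | ⟨u, w, a, rfl⟩)
    · have f1 := hE [w, a, b] (by simp)
      have du := finrank_inf_hyp_le ⊤ u
      rw [top_inf_eq] at du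
      have f2 := prod_mem ht N 3 hge [a, b] (hyp u) (by simp; omega)
      have dw := finrank_inf_hyp_le (hyp u) w
      have f3 := prod_mem ht N 3 hge [b] (hyp u ⊓ hyp w) (by simp; omega)
      have da := finrank_inf_hyp_le (hyp u ⊓ hyp w) a
      have f4 := hge (hyp u ⊓ hyp w ⊓ hyp a) (by omega)
      have db := finrank_inf_hyp_le (hyp u ⊓ hyp w ⊓ hyp a) b
      have f5 : ind (hyp u ⊓ hyp w ⊓ hyp a ⊓ hyp b) ∈ N := by
        by_cases hd : 3 ≤ Module.finrank 𝕂 (hyp u ⊓ hyp w ⊓ hyp a ⊓ hyp b : Submodule 𝕂 𝕍)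
        · exact hge _ hd
        have hd2 : Module.finrank 𝕂 (hyp u ⊓ hyp w ⊓ hyp a ⊓ hyp b : Submodule 𝕂 𝕍) = 2 := by omega
        refine h _ ?_ hd2
        set S := Submodule.span 𝕂 {u} ⊔ Submodule.span 𝕂 {w} with hS
        have hSp : sperp S = hyp u ⊓ hyp w := by rw [hS, sperp_sup, sperp_span, sperp_span]
        have hSle : S ≤ hyp u ⊓ hyp w ⊓ hyp a ⊓ hyp b := by
          refine sup_le ?_ ?_
          · rw [Submodule.span_singleton_le_iff_mem]
            exact ⟨⟨⟨sform_self u, e1⟩, e2⟩, e3⟩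
          · rw [Submodule.span_singleton_le_iff_mem]
            exact ⟨⟨⟨sform_comm_zero e1, sform_self w⟩, e4⟩, e5⟩
        have hSd : 2 ≤ Module.finrank 𝕂 S := by
          have g1 := finrank_sperp S
          have g2 := finrank_inf_hyp_le (hyp u ⊓ hyp w) a
          rw [hSp] at g1
          by_contra hc
          omega
        have heq : S = hyp u ⊓ hyp w ⊓ hyp a ⊓ hyp b := by
          apply Submodule.eq_of_le_of_finrank_le hSle; omega
        rw [← heq]
        exact totIso_sup_span (totIso_span u)
          (by rw [sperp_span, mem_hyp]; exact sform_comm_zero e1)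
      simp only [List.map_cons, List.map_nil, List.prod_cons, List.prod_nil, mul_one] at f1 f2 f3
      have e : Xf u * Xf w * Xf a * Xf b = Xf w * (Xf a * Xf b) - ind (hyp u) * (Xf a * Xf b) +
          ind (hyp u ⊓ hyp w) * Xf b - ind (hyp u ⊓ hyp w ⊓ hyp a) +
          ind (hyp u ⊓ hyp w ⊓ hyp a ⊓ hyp b) := by
        rw [ind_inf_hyp ht _ b, ind_inf_hyp ht _ a, ind_inf_hyp ht _ w, X_eq ht u]; ring
      rw [e]
      exact N.add_mem (N.sub_mem (N.add_mem (N.sub_mem f1 f2) f3) f4) f5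
    · have := hE [u, w, a] (by simp)
      simpa [mul_assoc] using this
  obtain ⟨n, hn, hn1⟩ := exists_n (p := p) ht hp2
  have hc := hle (coreA ht hp2 n hn hn1 MA_stab
    (fun u w a b e1 e2 e3 e4 e5 => Submodule.subset_span (Or.inl ⟨u, w, a, b, e1, e2, e3, e4, e5, rfl⟩))
    (fun u w a => Submodule.subset_span (Or.inr ⟨u, w, a, rfl⟩)))
  have hsum := four_mem N one hE (0, Pi.single 1 1) (0, Pi.single 2 1) (-Pi.single 1 1, 0)
    (-Pi.single 2 1, 0) (by
    convert hc using 1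
    rw [← x_eq, ← x_eq, ← y_eq, ← y_eq]
    ext v; simp only [Pi.mul_apply, mul_pow]; ring)
  convert hsum using 1
  rw [← x_eq, ← x_eq, ← y_eq, ← y_eq]
  ext v
  simp only [Pi.mul_apply, Pi.sub_apply, Pi.one_apply, pow_q1 ht]
  split_ifs <;> simp_all

end six
end IE

namespace IE
section link
variable {p t m : ℕ} [hp : Fact p.Prime]
local notation "𝕂" => GaloisField p t
local notation "𝕍" => SympV p t m
local notation "𝕊" => SympV p t 3

def iot (a b : Fin 3 → 𝕍) : 𝕊 →ₗ[𝕂] 𝕍 where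
  toFun s := ∑ i, (s.1 i • a i + s.2 i • b i)
  map_add' s s' := by
    rw [← Finset.sum_add_distrib]
    exact Finset.sum_congr rfl fun i _ => by simp only [Prod.fst_add, Prod.snd_add, Pi.add_apply]; module
  map_smul' c s := by
    rw [Finset.smul_sum]
    exact Finset.sum_congr rfl fun i _ => by
      simp only [Prod.smul_fst, Prod.smul_snd, Pi.smul_apply, smul_eq_mul, RingHom.id_apply]; module

def pim (a b : Fin 3 → 𝕍) (v : 𝕍) : 𝕊 := (fun i => sform v (b i), fun i => - sform v (a i))

lemma pim_add (a b : Fin 3 → 𝕍) (v w : 𝕍) : pim a b (v + w) = pim a b v + pim a b w := by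
  ext i <;> simp [pim, sform_add_left, add_comm]

lemma sform_iot (a b : Fin 3 → 𝕍) (v : 𝕍) (s : 𝕊) :
    sform v (iot a b s) = sform (pim a b v) s := by
  simp only [iot, LinearMap.coe_mk, AddHom.coe_mk, Fin.sum_univ_three, sform_add_right,
    sform_smul_right]
  have e : sform (pim a b v) s =
    ∑ i : Fin 3, ((pim a b v).1 i * s.2 i - (pim a b v).2 i * s.1 i) := rfl
  rw [e]
  simp only [pim, Fin.sum_univ_three]
  ring

structure HypTriple (a b : Fin 3 → 𝕍) : Prop where
  ab : ∀ i j, sform (a i) (b j) = if i = j then 1 else 0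
  aa : ∀ i j, sform (a i) (a j) = 0
  bb : ∀ i j, sform (b i) (b j) = 0

lemma pim_iot {a b : Fin 3 → 𝕍} (h : HypTriple a b) (s : 𝕊) : pim a b (iot a b s) = s := by
  have ba : ∀ i j, sform (b i) (a j) = if i = j then -1 else 0 := by
    intro i j; rw [sform_swap, h.ab]; split_ifs <;> simp_all
  ext i
  · simp only [pim, iot, LinearMap.coe_mk, AddHom.coe_mk, Fin.sum_univ_three, sform_add_left,
      sform_smul_left, h.ab, h.bb]
    fin_cases i <;> simp
  · simp only [pim, iot, LinearMap.coe_mk, AddHom.coe_mk, Fin.sum_univ_three, sform_add_left,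
      sform_smul_left, h.aa, ba]
    fin_cases i <;> simp

lemma proj_mem {S : Submodule 𝕂 𝕍} {a b x : 𝕍} (ha : a ∈ S) (hb : b ∈ S) (hab : sform a b = 1)
    (hx : x ∈ S) : x - sform x b • a + sform x a • b ∈ S ⊓ hyp a ⊓ hyp b := by
  have hba : sform b a = -1 := by rw [sform_swap, hab]
  have e : x - sform x b • a + sform x a • b = x + (-sform x b) • a + sform x a • b := by module
  refine ⟨⟨?_, ?_⟩, ?_⟩
  · exact S.add_mem (S.sub_mem hx (S.smul_mem _ ha)) (S.smul_mem _ hb)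
  · show sform _ _ = 0
    rw [e]; simp only [sform_add_left, sform_smul_left, sform_self, hba]; ring
  · show sform _ _ = 0
    rw [e]; simp only [sform_add_left, sform_smul_left, sform_self, hab]; ring

lemma hyp_pair {S : Submodule 𝕂 𝕍} (h : ¬ IsTotIso S) : ∃ a ∈ S, ∃ b ∈ S, sform a b = 1 := by
  simp only [IsTotIso] at h; push Not at h
  obtain ⟨a, ha, b, hb, hab⟩ := h
  exact ⟨a, ha, (sform a b)⁻¹ • b, S.smul_mem _ hb, by
    rw [sform_smul_right, inv_mul_cancel₀ hab]⟩

lemma finrank_W0 {W : Submodule 𝕂 𝕍} {a b : 𝕍} (ha : a ∈ W) (hb : b ∈ W) (hab : sform a b = 1) :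
    Module.finrank 𝕂 (W ⊓ hyp a ⊓ hyp b : Submodule 𝕂 𝕍) + 2 = Module.finrank 𝕂 W := by
  have h1 : a ∉ sperp W := fun h => by rw [mem_sperp.1 h b hb] at hab; exact zero_ne_one hab
  have h2 : b ∉ sperp (W ⊓ hyp a) := fun h => by
    rw [sform_comm_zero (mem_sperp.1 h a ⟨ha, sform_self a⟩)] at hab; exact zero_ne_one hab
  have e1 := finrank_inf_hyp h1
  have e2 := finrank_inf_hyp h2
  omega

lemma exists_triple {W : Submodule 𝕂 𝕍} (hd : Module.finrank 𝕂 W < m) (hW : ¬ IsTotIso W) :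
    ∃ a b : Fin 3 → 𝕍, HypTriple a b ∧ a 0 ∈ W ∧ b 0 ∈ W ∧
      a 1 ∈ sperp W ∧ b 1 ∈ sperp W ∧ a 2 ∈ sperp W ∧ b 2 ∈ sperp W := by
  obtain ⟨a0, ha0, b0, hb0, h0⟩ := hyp_pair hW
  have hdW := finrank_sperp W
  have hW0 := finrank_W0 ha0 hb0 h0
  obtain ⟨a1, ha1, b1, hb1, h1⟩ := hyp_pair (S := sperp W) (by
    intro h
    rw [totIso_iff, sperp_sperp] at h
    have := Submodule.finrank_mono h
    omega)
  obtain ⟨a2, ha2, b2, hb2, h2⟩ := hyp_pair (S := sperp W ⊓ hyp a1 ⊓ hyp b1) (by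
    intro h
    have hf := finrank_W0 ha1 hb1 h1
    have hle : sperp W ⊓ hyp a1 ⊓ hyp b1 ≤ W ⊓ hyp a0 ⊓ hyp b0 := by
      intro u hu
      have huW : u ∈ W := by
        rw [← sperp_sperp W, mem_sperp]
        intro x hx
        have e := h u hu _ (proj_mem ha1 hb1 h1 hx)
        have e1 : sform u a1 = 0 := hu.1.2
        have e2 : sform u b1 = 0 := hu.2
        rw [show x - sform x b1 • a1 + sform x a1 • b1 = x + (-sform x b1) • a1 + sform x a1 • b1 by module,
          sform_add_right, sform_add_right, sform_smul_right, sform_smul_right, e1, e2] at e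
        simpa using e
      exact ⟨⟨huW, mem_sperp.1 hu.1.1 a0 ha0⟩, mem_sperp.1 hu.1.1 b0 hb0⟩
    have := Submodule.finrank_mono hle
    omega)
  have pW : ∀ x ∈ sperp W, ∀ y ∈ W, sform x y = 0 ∧ sform y x = 0 := fun x hx y hy =>
    ⟨mem_sperp.1 hx y hy, sform_comm_zero (mem_sperp.1 hx y hy)⟩
  have a2a1 : sform a2 a1 = 0 := ha2.1.2
  have a2b1 : sform a2 b1 = 0 := ha2.2
  have b2a1 : sform b2 a1 = 0 := hb2.1.2
  have b2b1 : sform b2 b1 = 0 := hb2.2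
  have ha2' := ha2.1.1
  have hb2' := hb2.1.1
  refine ⟨![a0, a1, a2], ![b0, b1, b2], ⟨?_, ?_, ?_⟩, ha0, hb0, ha1, hb1, ha2', hb2'⟩
  · intro i j
    fin_cases i <;> fin_cases j <;>
      simp [h0, h1, h2, a2b1, sform_comm_zero b2a1, pW _ ha1 _ hb0, pW _ ha2' _ hb0, pW _ hb1 _ ha0,
        pW _ hb2' _ ha0]
  · intro i j
    fin_cases i <;> fin_cases j <;>
      simp [sform_self, a2a1, sform_comm_zero a2a1, pW _ ha1 _ ha0, pW _ ha2' _ ha0]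
  · intro i j
    fin_cases i <;> fin_cases j <;>
      simp [sform_self, b2b1, sform_comm_zero b2b1, pW _ hb1 _ hb0, pW _ hb2' _ hb0]

lemma replace_geom {W : Submodule 𝕂 𝕍} {a b : Fin 3 → 𝕍} (h : HypTriple a b)
    (ha0 : a 0 ∈ W) (hb0 : b 0 ∈ W) (ha1 : a 1 ∈ sperp W) (hb1 : b 1 ∈ sperp W)
    (ha2 : a 2 ∈ sperp W) (hb2 : b 2 ∈ sperp W) (L : Submodule 𝕂 𝕊) (hL : IsTotIso L)
    (hL2 : Module.finrank 𝕂 L = 2) :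
    (∀ v ∈ W ⊓ hyp (a 0) ⊓ hyp (b 0), pim a b v = 0) ∧
    Module.finrank 𝕂 (W ⊓ hyp (a 0) ⊓ hyp (b 0) ⊔ L.map (iot a b) : Submodule 𝕂 𝕍) =
      Module.finrank 𝕂 W ∧
    Module.finrank 𝕂 (W ⊓ sperp W : Submodule 𝕂 𝕍) <
      Module.finrank 𝕂 ((W ⊓ hyp (a 0) ⊓ hyp (b 0) ⊔ L.map (iot a b)) ⊓
        sperp (W ⊓ hyp (a 0) ⊓ hyp (b 0) ⊔ L.map (iot a b)) : Submodule 𝕂 𝕍) := by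
  have hpi : ∀ v ∈ W ⊓ hyp (a 0) ⊓ hyp (b 0), pim a b v = 0 := by
    rintro v ⟨⟨hv, h1⟩, h2⟩
    replace h1 : sform v (a 0) = 0 := h1
    replace h2 : sform v (b 0) = 0 := h2
    have e1 := sform_comm_zero (mem_sperp.1 ha1 v hv)
    have e2 := sform_comm_zero (mem_sperp.1 hb1 v hv)
    have e3 := sform_comm_zero (mem_sperp.1 ha2 v hv)
    have e4 := sform_comm_zero (mem_sperp.1 hb2 v hv)
    ext i <;> fin_cases i <;> simp [pim, *]
  refine ⟨hpi, ?_, ?_⟩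
  · have hinj : Function.Injective (iot a b) := fun s s' hss => by
      rw [← pim_iot h s, hss, pim_iot h]
    have e1 := Submodule.finrank_sup_add_finrank_inf_eq (W ⊓ hyp (a 0) ⊓ hyp (b 0)) (L.map (iot a b))
    have e2 : W ⊓ hyp (a 0) ⊓ hyp (b 0) ⊓ L.map (iot a b) = ⊥ := by
      rw [eq_bot_iff]; rintro v ⟨hv, s, hs, rfl⟩
      have := hpi _ hv
      rw [pim_iot h] at this
      simp [this]
    have e3 := finrank_W0 ha0 hb0 (by simpa using h.ab 0 0)
    have e4 := (Submodule.equivMapOfInjective (iot a b) hinj L).finrank_eq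
    rw [e2, finrank_bot, ← e4] at e1
    omega
  · apply Submodule.finrank_lt_finrank_of_lt
    have hpW : W ⊓ sperp W ≤ W ⊓ hyp (a 0) ⊓ hyp (b 0) := by
      rintro v ⟨hv, hv'⟩
      exact ⟨⟨hv, mem_sperp.1 hv' _ ha0⟩, mem_sperp.1 hv' _ hb0⟩
    refine lt_of_le_of_ne ?_ ?_
    · refine le_inf (hpW.trans le_sup_left) ?_
      rw [sperp_sup]
      refine le_inf ?_ ?_
      · rintro v ⟨hv, hv'⟩
        exact mem_sperp.2 fun w hw => mem_sperp.1 hv' w hw.1.1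
      · intro v hv
        rw [mem_sperp]; rintro _ ⟨s, hs, rfl⟩
        rw [sform_iot, hpi v (hpW hv), sform_zero_left]
    · intro heq
      obtain ⟨s, hs, hs0⟩ := exists_not_mem_of_finrank_lt (A := (⊥ : Submodule 𝕂 𝕊)) (B := L)
        (by rw [finrank_bot]; omega)
      have hmem : iot a b s ∈ W ⊓ sperp W := by
        rw [heq]
        refine ⟨Submodule.mem_sup_right ⟨s, hs, rfl⟩, ?_⟩
        rw [sperp_sup]
        refine ⟨?_, ?_⟩
        · refine mem_sperp.2 fun w hw => sform_comm_zero ?_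
          rw [sform_iot, hpi w hw, sform_zero_left]
        · refine mem_sperp.2 ?_
          rintro _ ⟨s', hs', rfl⟩
          rw [sform_iot, pim_iot h]; exact hL s hs s' hs'
      have := hpi _ (hpW hmem)
      rw [pim_iot h] at this
      subst this; simp at hs0

def Phi (Y : Submodule 𝕂 𝕍) (a b : Fin 3 → 𝕍) : (𝕊 → 𝕂) →ₗ[𝕂] (𝕍 → 𝕂) where
  toFun F := fun v => ind Y v * F (pim a b v)
  map_add' F G := by ext v; simp [mul_add]
  map_smul' c F := by ext v; simp; ring

lemma linkA (ht : t ≠ 0) (hp2 : p ≠ 2) (N : Submodule 𝕂 (𝕍 → 𝕂)) (d : ℕ) (hd : d < m)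
    (hN : ∀ W : Submodule 𝕂 𝕍, IsTotIso W → Module.finrank 𝕂 W = d → ind W ∈ N) (k : ℕ)
    (W : Submodule 𝕂 𝕍) (hWd : Module.finrank 𝕂 W = d)
    (hk : d ≤ Module.finrank 𝕂 (W ⊓ sperp W : Submodule 𝕂 𝕍) + k) : ind W ∈ N := by
  induction k generalizing W with
  | zero =>
    refine hN W ?_ hWd
    have := Submodule.eq_of_le_of_finrank_le (inf_le_left : W ⊓ sperp W ≤ W) (by omega)
    rw [totIso_iff, ← inf_eq_left]; exact this
  | succ k ih =>
    by_cases hW : IsTotIso W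
    · exact hN W hW hWd
    obtain ⟨a, b, h, ha0, hb0, ha1, hb1, ha2, hb2⟩ := exists_triple (by omega) hW
    have hpi : ∀ v ∈ W ⊓ hyp (a 0) ⊓ hyp (b 0), pim a b v = 0 := by
      rintro v ⟨⟨hv, h1⟩, h2⟩
      replace h1 : sform v (a 0) = 0 := h1
      replace h2 : sform v (b 0) = 0 := h2
      have e1 := sform_comm_zero (mem_sperp.1 ha1 v hv)
      have e2 := sform_comm_zero (mem_sperp.1 hb1 v hv)
      have e3 := sform_comm_zero (mem_sperp.1 ha2 v hv)
      have e4 := sform_comm_zero (mem_sperp.1 hb2 v hv)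
      ext i <;> fin_cases i <;> simp [pim, *]
    set W0 := W ⊓ hyp (a 0) ⊓ hyp (b 0) with hW0
    have key := A6 ht hp2 (N.comap (Phi (W0 ⊔ LinearMap.range (iot a b)) a b)) (by
      intro L hL hL2
      obtain ⟨-, g2, g3⟩ := replace_geom h ha0 hb0 ha1 hb1 ha2 hb2 L hL hL2
      have := ih _ (g2.trans hWd) (by omega)
      rw [Submodule.mem_comap]
      convert this using 1
      ext v
      simp only [Phi, LinearMap.coe_mk, AddHom.coe_mk, ind]
      have : v ∈ W0 ⊔ L.map (iot a b) ↔ v ∈ W0 ⊔ LinearMap.range (iot a b) ∧ pim a b v ∈ L := by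
        constructor
        · intro hv
          obtain ⟨w, hw, _, ⟨s, hs, rfl⟩, rfl⟩ := Submodule.mem_sup.1 hv
          refine ⟨Submodule.add_mem_sup hw ⟨s, rfl⟩, ?_⟩
          rw [pim_add, hpi w hw, zero_add, pim_iot h]; exact hs
        · rintro ⟨hv, hL'⟩
          obtain ⟨w, hw, _, ⟨s, rfl⟩, rfl⟩ := Submodule.mem_sup.1 hv
          rw [pim_add, hpi w hw, zero_add, pim_iot h] at hL'
          exact Submodule.add_mem_sup hw ⟨s, hL', rfl⟩
      rw [← hW0]
      split_ifs <;> simp_all)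
    rw [Submodule.mem_comap] at key
    convert key using 1
    ext v
    simp only [Phi, LinearMap.coe_mk, AddHom.coe_mk, ind]
    have : v ∈ W ↔ v ∈ W0 ⊔ LinearMap.range (iot a b) ∧ ((pim a b v).1 1 = 0 ∧ (pim a b v).2 1 = 0 ∧
        (pim a b v).1 2 = 0 ∧ (pim a b v).2 2 = 0) := by
      constructor
      · intro hv
        refine ⟨?_, ?_⟩
        · have e := proj_mem ha0 hb0 (by simpa using h.ab 0 0) hv
          have e2 : v = (v - sform v (b 0) • a 0 + sform v (a 0) • b 0) +
            iot a b (Pi.single 0 (sform v (b 0)), Pi.single 0 (-sform v (a 0))) := by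
            simp [iot, Fin.sum_univ_three]
            try abel
          rw [e2]
          exact Submodule.add_mem_sup e ⟨_, rfl⟩
        · have e1 := sform_comm_zero (mem_sperp.1 ha1 v hv)
          have e2 := sform_comm_zero (mem_sperp.1 hb1 v hv)
          have e3 := sform_comm_zero (mem_sperp.1 ha2 v hv)
          have e4 := sform_comm_zero (mem_sperp.1 hb2 v hv)
          simp [pim, *]
      · rintro ⟨hv, h1, h2, h3, h4⟩
        obtain ⟨w, hw, _, ⟨s, rfl⟩, rfl⟩ := Submodule.mem_sup.1 hv
        rw [pim_add, hpi w hw, zero_add, pim_iot h] at h1 h2 h3 h4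
        refine W.add_mem hw.1.1 ?_
        simp only [iot, LinearMap.coe_mk, AddHom.coe_mk, Fin.sum_univ_three, h1, h2, h3, h4,
          zero_smul, add_zero]
        exact W.add_mem (W.smul_mem _ ha0) (W.smul_mem _ hb0)
    clear_value W0
    clear * - this
    by_cases hv : v ∈ W
    · obtain ⟨h1, h2⟩ := this.1 hv
      rw [if_pos hv, if_pos h1, if_pos h2, mul_one]
    · rw [if_neg hv]
      by_cases h1 : v ∈ W0 ⊔ LinearMap.range (iot a b)
      · rw [if_neg (fun h2 => hv (this.2 ⟨h1, h2⟩)), mul_zero]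
      · rw [if_neg h1, zero_mul]

lemma linkB (ht : t ≠ 0) (hp2 : p ≠ 2) (N : Submodule 𝕂 (𝕍 → 𝕂)) (d : ℕ) (hd : d < m)
    (hN : ∀ W : Submodule 𝕂 𝕍, IsTotIso W → Module.finrank 𝕂 W = d → ind (sperp W) ∈ N) (k : ℕ)
    (W : Submodule 𝕂 𝕍) (hWd : Module.finrank 𝕂 W = d)
    (hk : d ≤ Module.finrank 𝕂 (W ⊓ sperp W : Submodule 𝕂 𝕍) + k) : ind (sperp W) ∈ N := by
  induction k generalizing W with
  | zero =>
    refine hN W ?_ hWd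
    have := Submodule.eq_of_le_of_finrank_le (inf_le_left : W ⊓ sperp W ≤ W) (by omega)
    rw [totIso_iff, ← inf_eq_left]; exact this
  | succ k ih =>
    by_cases hW : IsTotIso W
    · exact hN W hW hWd
    obtain ⟨a, b, h, ha0, hb0, ha1, hb1, ha2, hb2⟩ := exists_triple (by omega) hW
    set W0 := W ⊓ hyp (a 0) ⊓ hyp (b 0) with hW0
    have key := B6 ht hp2 (N.comap (Phi (sperp W0) a b)) (by
      intro L hL hL2
      obtain ⟨-, g2, g3⟩ := replace_geom h ha0 hb0 ha1 hb1 ha2 hb2 L hL hL2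
      have := ih _ (g2.trans hWd) (by omega)
      rw [Submodule.mem_comap]
      convert this using 1
      ext v
      simp only [Phi, LinearMap.coe_mk, AddHom.coe_mk, ind]
      have : v ∈ sperp (W0 ⊔ L.map (iot a b)) ↔ v ∈ sperp W0 ∧ pim a b v ∈ sperp L := by
        rw [sperp_sup, Submodule.mem_inf]
        refine and_congr_right fun _ => ?_
        rw [mem_sperp, mem_sperp]
        constructor
        · intro hv s hs
          rw [← sform_iot]; exact hv _ ⟨s, hs, rfl⟩
        · rintro hv _ ⟨s, hs, rfl⟩
          rw [sform_iot]; exact hv s hs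
      rw [← hW0]
      split_ifs <;> simp_all)
    rw [Submodule.mem_comap] at key
    convert key using 1
    ext v
    simp only [Phi, LinearMap.coe_mk, AddHom.coe_mk, ind]
    have : v ∈ sperp W ↔ v ∈ sperp W0 ∧ ((pim a b v).1 0 = 0 ∧ (pim a b v).2 0 = 0) := by
      simp only [pim, neg_eq_zero]
      constructor
      · intro hv
        exact ⟨mem_sperp.2 fun w hw => mem_sperp.1 hv w hw.1.1, mem_sperp.1 hv _ hb0,
          mem_sperp.1 hv _ ha0⟩
      · rintro ⟨hv, h1, h2⟩
        refine mem_sperp.2 fun w hw => ?_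
        have e := mem_sperp.1 hv _ (proj_mem ha0 hb0 (by simpa using h.ab 0 0) hw)
        rw [show w - sform w (b 0) • a 0 + sform w (a 0) • b 0 =
          w + (-sform w (b 0)) • a 0 + sform w (a 0) • b 0 by module,
          sform_add_right, sform_add_right, sform_smul_right, sform_smul_right, h1, h2] at e
        simpa using e
    split_ifs <;> simp_all

end link
end IE

namespace IE

section digits
lemma dig_lt (p : ℕ) (t : ℕ) (f : ℕ → ℕ) (hf : ∀ j, f j < p) :
    ∑ i ∈ Finset.range t, p ^ i * f i < p ^ t := by
  induction t with
  | zero => simp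
  | succ t ih =>
    rw [Finset.sum_range_succ, pow_succ]
    have := hf t
    have h2 : p ^ t * f t + p ^ t ≤ p ^ t * p := by
      rw [← Nat.mul_succ]; exact Nat.mul_le_mul_left _ this
    omega

lemma dig_get (p : ℕ) (hp : 0 < p) (t : ℕ) (f : ℕ → ℕ) (hf : ∀ j, f j < p) (j : ℕ) (hj : j < t) :
    (∑ i ∈ Finset.range t, p ^ i * f i) / p ^ j % p = f j := by
  induction t generalizing f j with
  | zero => omega
  | succ t ih =>
    have e : ∑ i ∈ Finset.range (t + 1), p ^ i * f i =
        f 0 + p * ∑ i ∈ Finset.range t, p ^ i * f (i + 1) := by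
      rw [Finset.sum_range_succ', Finset.mul_sum, add_comm]
      simp [pow_succ', mul_assoc]
    rw [e]
    cases j with
    | zero => simp [Nat.mod_eq_of_lt (hf 0)]
    | succ j =>
      rw [pow_succ', ← Nat.div_div_eq_div_mul, Nat.add_mul_div_left _ _ hp,
        Nat.div_eq_of_lt (hf 0), zero_add]
      exact ih (fun i => f (i + 1)) (fun i => hf _) j (by omega)

lemma dig_sum (p : ℕ) (t : ℕ) (a : ℕ) (ha : a < p ^ t) :
    ∑ i ∈ Finset.range t, p ^ i * (a / p ^ i % p) = a := by
  induction t generalizing a with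
  | zero => simp at ha; simp [ha]
  | succ t ih =>
    have h := ih (a / p) (Nat.div_lt_of_lt_mul (by rwa [← pow_succ']))
    rw [Finset.sum_range_succ']
    have e : ∀ i, p ^ (i + 1) * (a / p ^ (i + 1) % p) = p * (p ^ i * (a / p / p ^ i % p)) := by
      intro i
      rw [Nat.div_div_eq_div_mul, ← pow_succ', pow_succ' p i, mul_assoc]
    simp only [e, ← Finset.mul_sum, h]
    simp [Nat.div_add_mod]

end digits

section
variable {p t m : ℕ} [Fact p.Prime]
local notation "𝕂" => GaloisField p t
local notation "𝕍" => SympV p t m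
local notation "σ" => Fin m ⊕ Fin m
local notation "𝔸" => Fin t → Fin m ⊕ Fin m → ℕ

def ex (p : ℕ) {t m : ℕ} (A : Fin t → Fin m ⊕ Fin m → ℕ) (z : Fin m ⊕ Fin m) : ℕ :=
  ∑ j : Fin t, p ^ (j : ℕ) * A j z

def phi (A : 𝔸) (x : σ → 𝕂) : 𝕂 := ∏ z, x z ^ ex p A z

def co (v : 𝕍) : σ → 𝕂 := Sum.elim v.1 v.2

def Ph (A : 𝔸) : 𝕍 → 𝕂 := fun v => phi A (co v)

def ls (A : 𝔸) (j : Fin t) : ℕ := ∑ z, A j z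

def El (j : Fin t) (z : σ) : 𝔸 := Pi.single j (Pi.single z 1)

lemma ex_add (A B : 𝔸) (z : σ) : ex p (A + B) z = ex p A z + ex p B z := by
  simp [ex, mul_add, Finset.sum_add_distrib]

lemma ls_add (A B : 𝔸) (j : Fin t) : ls (A + B) j = ls A j + ls B j := by
  simp [ls, Finset.sum_add_distrib]

lemma ex_smul (n : ℕ) (A : 𝔸) (z : σ) : ex p (n • A) z = n * ex p A z := by
  simp [ex, Finset.mul_sum, mul_left_comm]

lemma ls_smul (n : ℕ) (A : 𝔸) (j : Fin t) : ls (n • A) j = n * ls A j := by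
  simp only [ls, Finset.mul_sum, Pi.smul_apply, smul_eq_mul]

lemma ex_El (j : Fin t) (z w : σ) : ex p (El j z) w = if w = z then p ^ (j : ℕ) else 0 := by
  unfold ex El
  rw [Finset.sum_eq_single j]
  · simp [Pi.single_apply]
  · intro b _ hb; simp [Pi.single_apply, hb]
  · simp

lemma ls_El (j k : Fin t) (z : σ) : ls (El j z) k = if k = j then 1 else 0 := by
  unfold ls El
  by_cases h : k = j
  · subst h; simp
  · simp [h]

lemma phi_add (A B : 𝔸) (x : σ → 𝕂) : phi (p := p) (A + B) x = phi A x * phi B x := by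
  simp [phi, ex_add, pow_add, Finset.prod_mul_distrib]

lemma Ph_add (A B : 𝔸) : (Ph (A + B) : 𝕍 → 𝕂) = Ph A * Ph B := by
  ext v; simp [Ph, phi_add]

lemma phi_El (n : ℕ) (j : Fin t) (z : σ) (x : σ → 𝕂) :
    phi (p := p) (n • El j z) x = x z ^ (n * p ^ (j : ℕ)) := by
  unfold phi
  rw [Finset.prod_eq_single z]
  · rw [ex_smul, ex_El, if_pos rfl]
  · intro b _ hb; rw [ex_smul, ex_El, if_neg hb, mul_zero, pow_zero]
  · simp

lemma phi_carry [NeZero t] (j : Fin t) (z : σ) (x : σ → 𝕂) :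
    phi (p := p) (p • El j z) x = phi (El (j + 1) z) x := by
  have h := phi_El (p := p) 1 (j + 1) z x
  rw [one_smul] at h
  rw [h, phi_El, one_mul, ← pow_succ']
  have ht := NeZero.ne t
  by_cases hj : (j : ℕ) + 1 < t
  · rw [Fin.val_add_one_of_lt' hj]
  · have hj' : (j : ℕ) + 1 = t := by have := j.2; omega
    have : ((j + 1 : Fin t) : ℕ) = 0 := by
      rw [Fin.val_add, Fin.val_one']
      simp [hj']
    rw [this, hj', pow_zero, pow_one]
    conv_lhs => rw [← cardK (p := p) ht]
    exact FiniteField.pow_card _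

lemma Ph_carry [NeZero t] (C : 𝔸) (j : Fin t) (z : σ) :
    (Ph (C + p • El j z) : 𝕍 → 𝕂) = Ph (C + El (j + 1) z) := by
  ext v; rw [Ph, Ph, phi_add, phi_add, phi_carry]

lemma split_El (n : ℕ) (A : 𝔸) (j : Fin t) (z : σ) (h : n ≤ A j z) :
    ∃ C : 𝔸, A = C + n • El j z := by
  refine ⟨A - n • El j z, ?_⟩
  ext j' z'
  simp only [Pi.add_apply, Pi.sub_apply, Pi.smul_apply, El, smul_eq_mul]
  by_cases hj : j' = j
  · subst hj
    by_cases hz : z' = z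
    · subst hz; simp; omega
    · simp [hz]
  · simp [hj]

lemma carry [NeZero t] (n : ℕ) (A : 𝔸) (s : Fin t → ℤ) (d : ℤ) (hn : ∑ j, ls A j ≤ n)
    (hs : ∀ j, 1 ≤ s j ∧ s j ≤ d) (hA : ∀ j, (ls A j : ℤ) = p * s (j + 1) - s j) :
    ∃ (A' : 𝔸) (s' : Fin t → ℤ), (Ph A' : 𝕍 → 𝕂) = Ph A ∧ (∀ j z, A' j z < p) ∧
      (∀ j, 1 ≤ s' j ∧ s' j ≤ d) ∧ (∀ j, (ls A' j : ℤ) = p * s' (j + 1) - s' j) := by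
  have hp : 2 ≤ p := (Fact.out : p.Prime).two_le
  induction n generalizing A s with
  | zero =>
    refine ⟨A, s, rfl, ?_, hs, hA⟩
    intro j z
    have h1 : ls A j ≤ ∑ j, ls A j := Finset.single_le_sum (f := ls A) (by simp) (by simp)
    have h2 : A j z ≤ ls A j := Finset.single_le_sum (f := A j) (by simp) (by simp)
    omega
  | succ n ih =>
    by_cases hlt : ∀ j z, A j z < p
    · exact ⟨A, s, rfl, hlt, hs, hA⟩
    push Not at hlt
    obtain ⟨j, z, hjz⟩ := hlt
    obtain ⟨C, rfl⟩ := split_El p A j z hjz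
    have hl : ∀ k, (ls (C + El (j + 1) z) k : ℤ) = p * (s (k + 1) - if k + 1 = j + 1 then 1 else 0) -
        (s k - if k = j + 1 then 1 else 0) := by
      intro k
      have h := hA k
      rw [ls_add, ls_smul, ls_El] at h
      rw [ls_add, ls_El]
      simp only [add_left_inj]
      push_cast at h ⊢
      linear_combination h
    have hn' : ∑ k, ls (C + El (j + 1) z) k ≤ n := by
      simp only [ls_add, ls_smul, ls_El, Finset.sum_add_distrib, ← Finset.mul_sum] at hn ⊢
      simp at hn ⊢
      omega
    have hs' : ∀ k, 1 ≤ (s k - if k = j + 1 then 1 else 0) ∧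
        (s k - if k = j + 1 then 1 else 0) ≤ d := by
      intro k
      have hk := hs k
      by_cases hkj : k = j + 1
      · subst hkj
        simp only [if_true]
        refine ⟨?_, by omega⟩
        by_contra hc
        have h0 : s (j + 1) = 1 := by omega
        have hlj := hl j
        simp only [if_true, h0, sub_self, mul_zero, zero_sub] at hlj
        by_cases hjj : j = j + 1
        · rw [← hjj] at hlj h0
          simp only [if_true, h0] at hlj
          rw [ls_add, ls_El] at hlj
          simp at hlj
          omega
        · simp only [hjj, if_false] at hlj
          have := hs j
          omega
      · simp only [hkj, if_false]; omega
    obtain ⟨A', s', h1, h2⟩ := ih (C + El (j + 1) z) (fun k => s k - if k = j + 1 then 1 else 0)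
      hn' hs' hl
    exact ⟨A', s', h1.trans (Ph_carry C j z).symm, h2⟩

lemma uncarry [NeZero t] (n : ℕ) (A : 𝔸) (s : Fin t → ℤ) (d : ℤ) (hn : ∑ j, (d - s j) ≤ n)
    (hs : ∀ j, 1 ≤ s j ∧ s j ≤ d) (hA : ∀ j, (ls A j : ℤ) = p * s (j + 1) - s j) :
    ∃ (A' : 𝔸), (Ph A' : 𝕍 → 𝕂) = Ph A ∧ (∀ j, (ls A' j : ℤ) = d * (p - 1)) := by
  have hp : 2 ≤ p := (Fact.out : p.Prime).two_le
  by_cases hall : ∀ j, s j = d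
  · exact ⟨A, rfl, fun j => by rw [hA, hall, hall]; ring⟩
  push Not at hall
  obtain ⟨j0, hj0⟩ := hall
  induction n generalizing A s j0 with
  | zero =>
    exfalso
    have : d - s j0 ≤ ∑ j, (d - s j) := Finset.single_le_sum (f := fun j => d - s j)
      (fun i _ => by have := hs i; show 0 ≤ d - s i; omega) (by simp)
    have := hs j0
    push_cast at hn
    omega
  | succ n ih =>
    obtain ⟨j, _, hj⟩ := Finset.exists_min_image Finset.univ s ⟨j0, by simp⟩
    have hjd : s j < d := by
      have h1 := hj j0 (by simp)
      have h2 := hs j0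
      omega
    have hex : ∃ z, 1 ≤ A j z := by
      by_contra hc
      push Not at hc
      have h0 : ls A j = 0 := Finset.sum_eq_zero fun z _ => by have := hc z; omega
      have h1 := hA j
      have h2 := hj (j + 1) (by simp)
      have h3 := hs j
      rw [h0] at h1
      have h4 : (2 : ℤ) * s (j + 1) ≤ p * s (j + 1) :=
        mul_le_mul_of_nonneg_right (by exact_mod_cast hp) (by omega)
      push_cast at h1
      omega
    obtain ⟨z, hz⟩ := hex
    obtain ⟨C, rfl⟩ := split_El 1 A j z hz
    rw [one_smul] at hA ⊢
    have hl : ∀ k, (ls (C + p • El (j - 1) z) k : ℤ) = p * (s (k + 1) + if k + 1 = j then 1 else 0) -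
        (s k + if k = j then 1 else 0) := by
      intro k
      have h := hA k
      rw [ls_add, ls_El] at h
      rw [ls_add, ls_smul, ls_El]
      have e : k = j - 1 ↔ k + 1 = j := eq_sub_iff_add_eq
      simp only [e]
      push_cast at h ⊢
      linear_combination h
    have hPh : (Ph (C + p • El (j - 1) z) : 𝕍 → 𝕂) = Ph (C + El j z) := by
      rw [Ph_carry, sub_add_cancel]
    rw [← hPh]
    have hs' : ∀ k, 1 ≤ (s k + if k = j then 1 else 0) ∧ (s k + if k = j then 1 else 0) ≤ d := by
      intro k
      have := hs k
      by_cases hk : k = j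
      · subst hk; simp; omega
      · simp only [hk, if_false]; omega
    have hn' : ∑ k, (d - (s k + if k = j then 1 else 0)) ≤ n := by
      have e : ∑ k, (d - (s k + if k = j then 1 else 0)) = ∑ k, (d - s k) - 1 := by
        simp only [← sub_sub]
        rw [Finset.sum_sub_distrib]; simp
      rw [e]; push_cast at hn; omega
    by_cases hall : ∀ k, (s k + if k = j then 1 else 0) = d
    · exact ⟨_, rfl, fun k => by rw [hl, hall, hall]; ring⟩
    · push Not at hall
      obtain ⟨j1, hj1⟩ := hall
      exact ih _ (fun k => s k + if k = j then 1 else 0) hn' hs' hl j1 hj1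

end
end IE

namespace IE

section
variable {p t m : ℕ} [Fact p.Prime]
local notation "𝕂" => GaloisField p t
local notation "𝕍" => SympV p t m
local notation "σ" => Fin m ⊕ Fin m
local notation "𝔸" => Fin t → Fin m ⊕ Fin m → ℕ

lemma geom_q (p : ℕ) (hp : 0 < p) (t : ℕ) : ∑ j : Fin t, p ^ (j : ℕ) * (p - 1) = p ^ t - 1 := by
  rw [Fin.sum_univ_eq_sum_range (fun j => p ^ j * (p - 1))]
  induction t with
  | zero => simp
  | succ t ih =>
    rw [Finset.sum_range_succ, ih, Nat.mul_sub, mul_one, pow_succ]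
    have : 1 ≤ p ^ t := Nat.one_le_pow _ _ hp
    have : p ^ t * 1 ≤ p ^ t * p := Nat.mul_le_mul_left _ hp
    omega

def BB (p t m : ℕ) : Finset (Fin t → Fin m ⊕ Fin m → ℕ) :=
  Fintype.piFinset (fun _ : Fin t => Finset.piAntidiag Finset.univ (p - 1))

lemma mem_BB {A : 𝔸} : A ∈ BB p t m ↔ ∀ j, ls A j = p - 1 := by
  simp [BB, ls]

lemma expand (c x : σ → 𝕂) : (∑ z, c z * x z) ^ (p ^ t - 1) =
    ∑ B ∈ BB p t m, (∏ j, (Nat.multinomial Finset.univ (B j) : 𝕂)) * phi B c * phi B x := by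
  rw [← geom_q p (Fact.out : p.Prime).pos t, ← Finset.prod_pow_eq_pow_sum]
  have h : ∀ j : Fin t, (∑ z, c z * x z) ^ (p ^ (j : ℕ) * (p - 1)) =
      ∑ k ∈ Finset.piAntidiag Finset.univ (p - 1), (Nat.multinomial Finset.univ k : 𝕂) *
        ∏ z, ((c z * x z) ^ (p ^ (j : ℕ))) ^ k z := by
    intro j
    rw [pow_mul, sum_pow_char_pow, Finset.sum_pow_eq_sum_piAntidiag]
  simp only [h]
  rw [Finset.prod_univ_sum]
  refine Finset.sum_congr rfl fun B _ => ?_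
  rw [Finset.prod_mul_distrib, mul_assoc, Finset.prod_comm]
  congr 1
  rw [phi, phi, ← Finset.prod_mul_distrib]
  refine Finset.prod_congr rfl fun z _ => ?_
  rw [← mul_pow, ex, ← Finset.prod_pow_eq_pow_sum]
  simp only [pow_mul]

lemma multi_ne {A : 𝔸} (hA : A ∈ BB p t m) :
    (∏ j, (Nat.multinomial Finset.univ (A j) : 𝕂)) ≠ 0 := by
  rw [Finset.prod_ne_zero_iff]
  intro j _
  have hp : p.Prime := Fact.out
  rw [Ne, CharP.cast_eq_zero_iff 𝕂 p]
  intro h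
  have h2 := Nat.multinomial_spec (s := Finset.univ) (f := A j)
  have h3 := mem_BB.1 hA j
  rw [ls] at h3
  rw [h3] at h2
  have h4 : p ∣ (p - 1).factorial := h2 ▸ (h.mul_left _)
  rw [hp.dvd_factorial] at h4
  have := hp.pos
  omega

lemma BB_lt {A : 𝔸} (hA : A ∈ BB p t m) (j : Fin t) (z : σ) : A j z < p := by
  have h2 : A j z ≤ ls A j := Finset.single_le_sum (f := A j) (by simp) (by simp)
  rw [mem_BB.1 hA j] at h2
  have : 0 < p := (Fact.out : p.Prime).pos
  omega

lemma ex_range (A : 𝔸) (z : σ) : ex p A z =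
    ∑ i ∈ Finset.range t, p ^ i * (if h : i < t then A ⟨i, h⟩ z else 0) := by
  rw [← Fin.sum_univ_eq_sum_range (fun i => p ^ i * (if h : i < t then A ⟨i, h⟩ z else 0))]
  simp [ex]

lemma ex_digit {A : 𝔸} (hA : ∀ j z, A j z < p) (j : Fin t) (z : σ) :
    ex p A z / p ^ (j : ℕ) % p = A j z := by
  have hp : 0 < p := (Fact.out : p.Prime).pos
  rw [ex_range, dig_get p hp t _ _ j j.2]
  · simp
  · intro i; split_ifs
    · exact hA _ _
    · exact hp

lemma ex_lt {A : 𝔸} (hA : ∀ j z, A j z < p) (z : σ) : ex p A z < p ^ t := by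
  have hp : 0 < p := (Fact.out : p.Prime).pos
  rw [ex_range]
  apply dig_lt
  intro i; split_ifs
  · exact hA _ _
  · exact hp

lemma ex_inj {A B : 𝔸} (hA : ∀ j z, A j z < p) (hB : ∀ j z, B j z < p)
    (h : ∀ z, ex p A z = ex p B z) : A = B := by
  ext j z
  rw [← ex_digit hA, ← ex_digit hB, h]

lemma phi_indep (ht : t ≠ 0) (a : 𝔸 → 𝕂) (h : ∀ c : σ → 𝕂, ∑ B ∈ BB p t m, a B * phi B c = 0)
    (B : 𝔸) (hB : B ∈ BB p t m) : a B = 0 := by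
  let e : 𝔸 → (σ →₀ ℕ) := fun B => Finsupp.equivFunOnFinite.symm (ex p B)
  let P : MvPolynomial σ 𝕂 := ∑ B ∈ BB p t m, MvPolynomial.monomial (e B) (a B)
  have hP : P = 0 := by
    apply MvPolynomial.eq_zero_of_eval_eq_zero
    · intro v
      rw [← h v]
      simp only [P, map_sum, MvPolynomial.eval_monomial]
      refine Finset.sum_congr rfl fun B _ => ?_
      congr 1
      rw [Finsupp.prod_fintype _ _ (by simp)]
      rfl
    · refine Submodule.sum_mem _ fun B hB => ?_
      rw [MvPolynomial.mem_restrictDegree]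
      intro s hs i
      have := MvPolynomial.support_monomial_subset hs
      rw [Finset.mem_singleton] at this
      subst this
      rw [cardK ht]
      have := ex_lt (BB_lt hB) i
      show ex p B i ≤ _
      omega
  have h1 := congrArg (MvPolynomial.coeff (e B)) hP
  simp only [P, MvPolynomial.coeff_sum, MvPolynomial.coeff_monomial, MvPolynomial.coeff_zero] at h1
  rw [Finset.sum_eq_single B] at h1
  · simpa using h1
  · intro C hC hCB
    rw [if_neg]
    intro he
    apply hCB
    apply ex_inj (BB_lt hC) (BB_lt hB)
    intro z
    exact DFunLike.congr_fun he z
  · intro h; exact absurd hB h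

def F1 (p t m : ℕ) [Fact p.Prime] : Submodule (GaloisField p t) (SympV p t m → GaloisField p t) :=
  Submodule.span _ (Set.range Xf)

def GG (p t m : ℕ) [Fact p.Prime] (d : ℕ) :
    Submodule (GaloisField p t) (SympV p t m → GaloisField p t) :=
  Submodule.span _ {f | ∃ A : Fin t → Fin m ⊕ Fin m → ℕ, (∀ j, ls A j = d * (p - 1)) ∧ f = Ph A}

lemma sform_co (v w : 𝕍) : sform v w = ∑ z, co ((w.2, -w.1) : 𝕍) z * co v z := by
  rw [Fintype.sum_sum_type, ← Finset.sum_add_distrib, sform]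
  refine Finset.sum_congr rfl fun i _ => ?_
  simp [co]; ring

lemma Xf_expand (w : 𝕍) : Xf w = ∑ B ∈ BB p t m,
    ((∏ j, (Nat.multinomial Finset.univ (B j) : 𝕂)) * phi B (co ((w.2, -w.1) : 𝕍))) •
      (Ph B : 𝕍 → 𝕂) := by
  ext v
  rw [Xf, sform_co, expand, Finset.sum_apply]
  rfl

lemma F1_le : F1 p t m ≤ GG p t m 1 := by
  rw [F1, Submodule.span_le]
  rintro _ ⟨w, rfl⟩
  rw [Xf_expand]
  refine Submodule.sum_mem _ fun B hB => Submodule.smul_mem _ _ (Submodule.subset_span ?_)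
  exact ⟨B, fun j => by rw [mem_BB.1 hB, one_mul], rfl⟩

lemma Ph_mem_F1 (ht : t ≠ 0) (B : 𝔸) (hB : B ∈ BB p t m) : (Ph B : 𝕍 → 𝕂) ∈ F1 p t m := by
  have key : (F1 p t m).mkQ (Ph B) = 0 := by
    rw [← Module.forall_dual_apply_eq_zero_iff 𝕂]
    intro g
    have h := phi_indep (p := p) (m := m) ht
      (fun B => (∏ j, (Nat.multinomial Finset.univ (B j) : 𝕂)) * g ((F1 p t m).mkQ (Ph B))) ?_ B hB
    · exact (mul_eq_zero.1 h).resolve_left (multi_ne hB)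
    · intro c
      have e : co (((fun i => c (Sum.inl i)), (fun i => c (Sum.inr i))) : 𝕍) = c := by
        ext z; cases z <;> rfl
      have h1 : Xf ((-(fun i => c (Sum.inr i)), (fun i => c (Sum.inl i))) : 𝕍) ∈ F1 p t m :=
        Submodule.subset_span ⟨_, rfl⟩
      rw [← Submodule.Quotient.mk_eq_zero, Xf_expand] at h1
      have h2 := congrArg g h1
      rw [← Submodule.mkQ_apply] at h2
      simp only [map_sum, map_smul, map_zero, neg_neg, e, smul_eq_mul] at h2
      rw [← h2]
      exact Finset.sum_congr rfl fun B _ => by ring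
  rwa [Submodule.mkQ_apply, Submodule.Quotient.mk_eq_zero] at key

lemma GG_mul (d e : ℕ) : GG p t m d * GG p t m e ≤ GG p t m (d + e) := by
  rw [GG, GG, Submodule.span_mul_span, Submodule.span_le]
  rintro _ ⟨_, ⟨A, hA, rfl⟩, _, ⟨B, hB, rfl⟩, rfl⟩
  refine Submodule.subset_span ⟨A + B, fun j => by rw [ls_add, hA, hB, add_mul], ?_⟩
  simp only [Ph_add]

lemma GG_zero_mem : (1 : 𝕍 → 𝕂) ∈ GG p t m 0 := by
  refine Submodule.subset_span ⟨0, fun j => by simp [ls], ?_⟩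
  ext v; simp [Ph, phi, ex]

lemma F1_pow_le (d : ℕ) : F1 p t m ^ d ≤ GG p t m d := by
  induction d with
  | zero => rw [pow_zero, Submodule.one_le]; exact GG_zero_mem
  | succ d ih =>
    rw [pow_succ]
    exact (mul_le_mul' ih F1_le).trans (GG_mul d 1)

lemma split_sum {ι : Type*} [Fintype ι] (k : ℕ) (f : ι → ℕ) (h : k ≤ ∑ i, f i) :
    ∃ g, g ≤ f ∧ ∑ i, g i = k := by
  induction k with
  | zero => exact ⟨0, fun i => by simp, by simp⟩
  | succ k ih =>
    obtain ⟨g, hg, hk⟩ := ih (by omega)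
    have : ∃ i, g i < f i := by
      by_contra hc
      push Not at hc
      have := Finset.sum_le_sum (s := Finset.univ) (fun i _ => hc i)
      omega
    obtain ⟨i, hi⟩ := this
    refine ⟨g + Pi.single i 1, ?_, ?_⟩
    · intro j
      by_cases hj : j = i
      · subst hj; simp; omega
      · simp [hj]; exact hg j
    · simp [Finset.sum_add_distrib, hk]

lemma Ph_mem_pow (ht : t ≠ 0) (d : ℕ) (A : 𝔸) (hA : ∀ j, ls A j = d * (p - 1)) :
    (Ph A : 𝕍 → 𝕂) ∈ F1 p t m ^ d := by
  induction d generalizing A with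
  | zero =>
    have : A = 0 := by
      ext j z
      have h := hA j
      rw [zero_mul, ls, Finset.sum_eq_zero_iff] at h
      exact h z (by simp)
    rw [pow_zero, this]
    have : (Ph (0 : 𝔸) : 𝕍 → 𝕂) = 1 := by ext v; simp [Ph, phi, ex]
    rw [this]; exact Submodule.one_le.1 le_rfl
  | succ d ih =>
    have h : ∀ j, ∃ g, g ≤ A j ∧ ∑ i, g i = p - 1 := fun j => by
      apply split_sum
      have := hA j
      rw [ls] at this
      rw [this, add_mul]
      omega
    choose B hB1 hB2 using h
    have hAB : A = (A - B) + B := by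
      ext j z
      have : B j z ≤ A j z := hB1 j z
      simp only [Pi.add_apply, Pi.sub_apply]
      omega
    rw [hAB, Ph_add, pow_succ]
    refine Submodule.mul_mem_mul (ih _ ?_) (Ph_mem_F1 ht _ (mem_BB.2 hB2))
    intro j
    have h1 := hA j
    rw [hAB, ls_add] at h1
    have h2 : ls B j = p - 1 := hB2 j
    rw [h2, add_mul] at h1
    omega

lemma sum_Ph (ht : t ≠ 0) (d : ℕ) (hd : d < 2 * m) (A : 𝔸) (hA : ∀ j, ls A j = d * (p - 1)) :
    ∑ v, (Ph A : 𝕍 → 𝕂) v = 0 := by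
  let e : σ →₀ ℕ := Finsupp.equivFunOnFinite.symm (ex p A)
  have h := MvPolynomial.sum_eval_eq_zero (MvPolynomial.monomial e (1 : 𝕂)) ?_
  · rw [← h]
    refine Fintype.sum_equiv (Equiv.sumArrowEquivProdArrow (Fin m) (Fin m) 𝕂).symm _ _ ?_
    intro v
    rw [MvPolynomial.eval_monomial, one_mul, Finsupp.prod_fintype _ _ (by simp)]
    rfl
  · rw [MvPolynomial.totalDegree_monomial _ one_ne_zero, Finsupp.sum_fintype _ _ (by simp)]
    have h1 : ∑ z, ex p A z = d * (p ^ t - 1) := by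
      rw [← geom_q p (Fact.out : p.Prime).pos t]
      simp only [ex]
      rw [Finset.sum_comm, Finset.mul_sum]
      refine Finset.sum_congr rfl fun j _ => ?_
      rw [← Finset.mul_sum]
      have := hA j
      rw [ls] at this
      rw [this]; ring
    have h2 : ∑ z, e z = ∑ z, ex p A z := rfl
    rw [h2, h1, cardK ht]
    simp only [Fintype.card_sum, Fintype.card_fin]
    have : 1 < p ^ t := Nat.one_lt_pow ht (Fact.out : p.Prime).one_lt
    rw [mul_comm]
    exact Nat.mul_lt_mul_of_pos_left (by omega) (by omega)

end
end IE

namespace IE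

section
variable {p t m : ℕ} [Fact p.Prime]
local notation "𝕂" => GaloisField p t
local notation "𝕍" => SympV p t m
local notation "σ" => Fin m ⊕ Fin m
local notation "𝔸" => Fin t → Fin m ⊕ Fin m → ℕ

def SB (p t m : ℕ) [Fact p.Prime] [NeZero t] (d : ℤ) : Set (SympV p t m → GaloisField p t) :=
  {f | ∃ (a b : Fin m → ℕ) (s' : Fin t → ℤ),
    (∀ i, a i ≤ p ^ t - 1) ∧ (∀ i, b i ≤ p ^ t - 1) ∧ memH p t m s' ∧
    (∀ j : Fin t, (mtype p a b (j : ℕ) : ℤ) = (p : ℤ) * s' (j + 1) - s' j) ∧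
    (∀ j, s' j ≤ d) ∧ f = bmono a b}

lemma SB_mono [NeZero t] {d e : ℤ} (h : d ≤ e) : SB p t m d ⊆ SB p t m e := by
  rintro f ⟨a, b, s, h1, h2, h3, h4, h5, h6⟩
  exact ⟨a, b, s, h1, h2, h3, h4, fun j => (h5 j).trans h, h6⟩

lemma Ph_eq_bmono (A : 𝔸) : (Ph A : 𝕍 → 𝕂) =
    bmono (fun i => ex p A (Sum.inl i)) (fun i => ex p A (Sum.inr i)) := by
  ext v
  rw [Ph, phi, Fintype.prod_sum_type, bmono, Finset.prod_mul_distrib]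
  rfl

lemma Ph_mem_SB [NeZero t] (e : ℕ) (he : 1 ≤ e) (he2 : e + 1 ≤ 2 * m) (A : 𝔸)
    (hA : ∀ j, ls A j = e * (p - 1)) : (Ph A : 𝕍 → 𝕂) ∈ SB p t m e := by
  have hp : 2 ≤ p := (Fact.out : p.Prime).two_le
  obtain ⟨A', s', h1, h2, h3, h4⟩ := carry (p := p) (m := m) _ A (fun _ => (e : ℤ)) e le_rfl
    (fun j => ⟨by exact_mod_cast he, le_rfl⟩) (fun j => by
      rw [hA]; push_cast [Nat.cast_sub (show 1 ≤ p by omega)]; ring)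
  rw [← h1, Ph_eq_bmono]
  refine ⟨_, _, s', ?_, ?_, ⟨?_, ?_⟩, ?_, fun j => (h3 j).2, rfl⟩
  · intro i; have := ex_lt h2 (Sum.inl i); omega
  · intro i; have := ex_lt h2 (Sum.inr i); omega
  · intro j; have := h3 j; omega
  · intro j
    rw [← h4 j]
    refine ⟨by positivity, ?_⟩
    have : ls A' j ≤ (2 * m) * (p - 1) := by
      calc ls A' j ≤ ∑ z : σ, (p - 1) :=
            Finset.sum_le_sum fun z _ => by have := h2 j z; omega
        _ = _ := by
          simp only [Finset.sum_const, Finset.card_univ, Fintype.card_sum, Fintype.card_fin,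
            smul_eq_mul]
          ring
    zify [show 1 ≤ p by omega] at this
    exact this
  · intro j
    rw [← h4 j, mtype]
    simp only [ex_digit h2]
    rw [Finset.sum_add_distrib, ← Fintype.sum_sum_type]
    rfl

lemma SB_sub [NeZero t] (d : ℕ) {f : 𝕍 → 𝕂} (hf : f ∈ SB p t m d) : f ∈ F1 p t m ^ d := by
  have hp : 2 ≤ p := (Fact.out : p.Prime).two_le
  obtain ⟨a, b, s, h1, h2, h3, h4, h5, rfl⟩ := hf
  let A : 𝔸 := fun j => Sum.elim (fun i => a i / p ^ (j : ℕ) % p) (fun i => b i / p ^ (j : ℕ) % p)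
  have hpt : 0 < p ^ t := Nat.pow_pos (by omega)
  have e : (Ph A : 𝕍 → 𝕂) = bmono a b := by
    rw [Ph_eq_bmono]
    congr 1
    · ext i
      rw [ex]
      simp only [A, Sum.elim_inl]
      rw [Fin.sum_univ_eq_sum_range (fun j => p ^ j * (a i / p ^ j % p)),
        dig_sum p t (a i) (by have := h1 i; omega)]
    · ext i
      rw [ex]
      simp only [A, Sum.elim_inr]
      rw [Fin.sum_univ_eq_sum_range (fun j => p ^ j * (b i / p ^ j % p)),
        dig_sum p t (b i) (by have := h2 i; omega)]
  obtain ⟨A', hA1, hA2⟩ := uncarry (p := p) (m := m) (∑ j, ((d : ℤ) - s j)).toNat A s d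
    (Int.self_le_toNat _) (fun j => ⟨(h3.1 j).1, h5 j⟩) (fun j => by
      rw [← h4 j, mtype, Finset.sum_add_distrib, ls, Fintype.sum_sum_type]; rfl)
  rw [← e, ← hA1]
  refine Ph_mem_pow (NeZero.ne t) d A' fun j => ?_
  have := hA2 j
  zify [show 1 ≤ p by omega]
  exact this

lemma exists_flag {U : Submodule 𝕂 𝕍} (h : Module.finrank 𝕂 U < 2 * m) :
    ∃ (U' : Submodule 𝕂 𝕍) (w : 𝕍), U = U' ⊓ hyp w ∧
      Module.finrank 𝕂 U' = Module.finrank 𝕂 U + 1 := by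
  obtain ⟨x, _, hx⟩ := exists_not_mem_of_finrank_lt (A := U) (B := ⊤)
    (by rw [finrank_top, finrankV]; exact h)
  have h1 := finrank_sup_span hx
  have h2 := finrank_sperp U
  have h3 := finrank_sperp (U ⊔ Submodule.span 𝕂 {x})
  obtain ⟨w, hw, hw'⟩ := exists_not_mem_of_finrank_lt (A := sperp (U ⊔ Submodule.span 𝕂 {x}))
    (B := sperp U) (by omega)
  refine ⟨U ⊔ Submodule.span 𝕂 {x}, w, ?_, h1⟩
  apply Submodule.eq_of_le_of_finrank_le
  · refine le_inf le_sup_left fun u hu => ?_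
    rw [mem_hyp]
    exact sform_comm_zero (mem_sperp.1 hw u hu)
  · have := finrank_inf_hyp hw'
    omega

lemma ind_mem_of_pow (ht : t ≠ 0) (N : Submodule 𝕂 (𝕍 → 𝕂)) (d : ℕ)
    (hN : ∀ e ≤ d, F1 p t m ^ e ≤ N) (k e : ℕ) (hke : k + e ≤ d) (U : Submodule 𝕂 𝕍)
    (hU : Module.finrank 𝕂 U + k = 2 * m) (g : 𝕍 → 𝕂) (hg : g ∈ F1 p t m ^ e) :
    ind U * g ∈ N := by
  induction k generalizing e U g with
  | zero =>
    have : U = ⊤ := Submodule.eq_top_of_finrank_eq (by rw [finrankV]; omega)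
    rw [this, ind_top, one_mul]
    exact hN e (by omega) hg
  | succ k ih =>
    obtain ⟨U', w, rfl, hU'⟩ := exists_flag (U := U) (by omega)
    rw [ind_inf_hyp ht]
    have e1 : ind U' * (1 - Xf w) * g = ind U' * g - ind U' * (g * Xf w) := by ring
    rw [e1]
    refine N.sub_mem (ih e (by omega) U' (by omega) g hg) (ih (e + 1) (by omega) U' (by omega) _ ?_)
    rw [pow_succ]
    exact Submodule.mul_mem_mul hg (Submodule.subset_span ⟨w, rfl⟩)

open scoped Pointwise in
lemma F1_pow_span (d : ℕ) : F1 p t m ^ d ≤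
    Submodule.span 𝕂 {f | ∃ l : List 𝕍, l.length = d ∧ f = (l.map Xf).prod} := by
  rw [F1, Submodule.span_pow]
  apply Submodule.span_mono
  induction d with
  | zero => rintro f hf; refine ⟨[], rfl, ?_⟩; simpa using hf
  | succ d ih =>
    rw [pow_succ']
    rintro _ ⟨_, ⟨w, rfl⟩, g, hg, rfl⟩
    obtain ⟨l, hl, rfl⟩ := ih hg
    exact ⟨w :: l, by simp [hl], by simp⟩

lemma F1_pow_inv (ht : t ≠ 0) (d : ℕ) (hd : 1 ≤ d) {f : 𝕍 → 𝕂} (hf : f ∈ F1 p t m ^ d) :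
    f 0 = 0 ∧ ∀ (c : 𝕂) (v : 𝕍), c ≠ 0 → f (c • v) = f v := by
  have hq : 1 < p ^ t := Nat.one_lt_pow ht (Fact.out : p.Prime).one_lt
  have hX : ∀ (w : 𝕍) (c : 𝕂) (v : 𝕍), c ≠ 0 → Xf w (c • v) = Xf w v := by
    intro w c v hc
    rw [Xf, Xf, sform_smul_left, mul_pow, pow_q1 ht c, if_neg hc, one_mul]
  have hl : ∀ (l : List 𝕍) (c : 𝕂) (v : 𝕍), c ≠ 0 → (l.map Xf).prod (c • v) = (l.map Xf).prod v := by
    intro l c v hc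
    induction l with
    | nil => simp
    | cons w l ih => simp only [List.map_cons, List.prod_cons, Pi.mul_apply, hX w c v hc, ih]
  have hf' := F1_pow_span d hf
  clear hf
  induction hf' using Submodule.span_induction with
  | mem x hx =>
    obtain ⟨l, hll, rfl⟩ := hx
    refine ⟨?_, hl l⟩
    cases l with
    | nil => simp at hll; omega
    | cons w l =>
      simp only [List.map_cons, List.prod_cons, Pi.mul_apply, Xf, sform_zero_left]
      rw [zero_pow (by omega), zero_mul]
  | zero => simp
  | add x y _ _ hx hy =>
    refine ⟨by rw [Pi.add_apply, hx.1, hy.1, add_zero], fun c v hc => ?_⟩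
    rw [Pi.add_apply, Pi.add_apply, hx.2 c v hc, hy.2 c v hc]
  | smul a x _ hx =>
    refine ⟨by rw [Pi.smul_apply, hx.1, smul_zero], fun c v hc => ?_⟩
    rw [Pi.smul_apply, Pi.smul_apply, hx.2 c v hc]

lemma sum_one (ht : t ≠ 0) (hm : 1 ≤ m) : ∑ _v : 𝕍, (1 : 𝕂) = 0 := by
  have h := sum_Ph (p := p) (m := m) ht 0 (by omega) 0 (fun j => by simp [ls])
  rw [← h]
  refine Finset.sum_congr rfl fun v _ => ?_
  simp [Ph, phi, ex]

lemma F1_pow_sum (ht : t ≠ 0) (d : ℕ) (hd : d < 2 * m) {f : 𝕍 → 𝕂} (hf : f ∈ F1 p t m ^ d) :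
    ∑ v, f v = 0 := by
  have hf' := F1_pow_le d hf
  clear hf
  induction hf' using Submodule.span_induction with
  | mem x hx =>
    obtain ⟨A, hA, rfl⟩ := hx
    exact sum_Ph ht d hd A hA
  | zero => simp
  | add x y _ _ hx hy => simp only [Pi.add_apply, Finset.sum_add_distrib, hx, hy, add_zero]
  | smul a x _ hx => simp only [Pi.smul_apply, ← Finset.smul_sum, hx, smul_zero]

lemma exists_rep (Z : Pts p t m) : ∃ v : 𝕍, v ∈ Z.val ∧ v ≠ 0 := by
  have : Z.val ≠ ⊥ := by
    intro h
    have := Z.2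
    rw [h, finrank_bot] at this
    omega
  obtain ⟨v, h1, h2⟩ := Submodule.exists_mem_ne_zero_of_ne_bot this
  exact ⟨v, h1, h2⟩

def rep (Z : Pts p t m) : 𝕍 := (exists_rep Z).choose
lemma rep_mem (Z : Pts p t m) : rep Z ∈ Z.val := (exists_rep Z).choose_spec.1
lemma rep_ne (Z : Pts p t m) : rep Z ≠ 0 := (exists_rep Z).choose_spec.2

lemma rep_smul (Z : Pts p t m) {v : 𝕍} (hv : v ∈ Z.val) : ∃ c : 𝕂, v = c • rep Z := by
  have h := (finrank_eq_one_iff_of_nonzero' (⟨rep Z, rep_mem Z⟩ : Z.val)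
    (by simpa using rep_ne Z)).1 Z.2 ⟨v, hv⟩
  obtain ⟨c, hc⟩ := h
  exact ⟨c, (congrArg Subtype.val hc).symm⟩

def Th (p t m : ℕ) [Fact p.Prime] : (SympV p t m → GaloisField p t) →ₗ[GaloisField p t]
    (Pts p t m → GaloisField p t) := LinearMap.funLeft _ _ rep

lemma Th_apply (f : 𝕍 → 𝕂) (Z : Pts p t m) : Th p t m f Z = f (rep Z) := rfl

lemma Th_ind (U : Submodule 𝕂 𝕍) : Th p t m (ind U) = chi U := by
  ext Z
  rw [Th_apply, ind, chi]
  have : rep Z ∈ U ↔ Z.val ≤ U := by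
    constructor
    · intro h v hv
      obtain ⟨c, rfl⟩ := rep_smul Z hv
      exact U.smul_mem _ h
    · intro h; exact h (rep_mem Z)
  simp only [this]

lemma Th_SB [NeZero t] (d : ℕ) (hd : 1 ≤ d) (D : ℤ) (hD : D = d) : Set.image (Th p t m) (SB p t m d) =
    {F | ∃ (a b : Fin m → ℕ) (s' : Fin t → ℤ),
            (∀ i, a i ≤ p ^ t - 1) ∧ (∀ i, b i ≤ p ^ t - 1) ∧
            memH p t m s' ∧
            (∀ j : Fin t, (mtype p a b (j : ℕ) : ℤ) =
              (p : ℤ) * s' (j + 1) - s' j) ∧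
            (∀ j, s' j ≤ D) ∧
            ∀ Z : Pts p t m, ∀ v ∈ Z.val, v ≠ 0 → F Z = bmono a b v} := by
  subst hD
  ext F
  constructor
  · rintro ⟨f, hf, rfl⟩
    have hinv := F1_pow_inv (NeZero.ne t) d hd (SB_sub d hf)
    obtain ⟨a, b, s, h1, h2, h3, h4, h5, rfl⟩ := hf
    refine ⟨a, b, s, h1, h2, h3, h4, h5, ?_⟩
    intro Z v hv hv0
    obtain ⟨c, rfl⟩ := rep_smul Z hv
    have hc : c ≠ 0 := by rintro rfl; simp at hv0
    rw [Th_apply, hinv.2 c _ hc]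
  · rintro ⟨a, b, s, h1, h2, h3, h4, h5, h6⟩
    refine ⟨bmono a b, ⟨a, b, s, h1, h2, h3, h4, h5, rfl⟩, ?_⟩
    ext Z
    rw [Th_apply, h6 Z _ (rep_mem Z) (rep_ne Z)]

lemma N_eq [NeZero t] (r d : ℕ) (hr : 1 ≤ r) (hd : 1 ≤ d) (hrd : r + d = 2 * m)
    (I : Set (Submodule 𝕂 𝕍)) (hI : ∀ U ∈ I, Module.finrank 𝕂 U = r)
    (hI2 : ∀ U : Submodule 𝕂 𝕍, Module.finrank 𝕂 U = r → ind U ∈ Submodule.span 𝕂 (Set.image ind I)) :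
    Submodule.span 𝕂 (Set.image ind I) = Submodule.span 𝕂 {(1 : 𝕍 → 𝕂)} ⊔
      Submodule.span 𝕂 (SB p t m d) := by
  have ht : t ≠ 0 := NeZero.ne t
  apply le_antisymm
  · rw [Submodule.span_le]
    rintro _ ⟨U, hU, rfl⟩
    have hU' := hI U hU
    rw [← mul_one (ind U)]
    refine ind_mem_of_pow ht _ d ?_ d 0 (by omega) U (by omega) 1 (by
      rw [pow_zero]; exact Submodule.one_le.1 le_rfl)
    intro e he
    rcases Nat.eq_zero_or_pos e with rfl | he0
    · rw [pow_zero, Submodule.one_le]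
      exact Submodule.mem_sup_left (Submodule.mem_span_singleton_self _)
    · refine (F1_pow_le e).trans (le_trans ?_ le_sup_right)
      rw [GG, Submodule.span_le]
      rintro _ ⟨A, hA, rfl⟩
      exact Submodule.subset_span (SB_mono (by exact_mod_cast he)
        (Ph_mem_SB e he0 (by omega) A hA))
  · have hge := ind_ge ht _ r hr hI2
    refine sup_le ?_ ?_
    · rw [Submodule.span_singleton_le_iff_mem, ← ind_top]
      exact hge ⊤ (by rw [finrank_top, finrankV]; omega)
    · rw [Submodule.span_le]
      intro f hf
      have hf' := F1_pow_span d (SB_sub d hf)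
      refine (Submodule.span_le.2 ?_) hf'
      rintro _ ⟨l, hl, rfl⟩
      have := prod_mem ht _ r hge l ⊤ (by rw [finrank_top, finrankV]; omega)
      rwa [ind_top, one_mul] at this

lemma disj [NeZero t] (d : ℕ) (hd : 1 ≤ d) (hd2 : d < 2 * m) :
    Submodule.span 𝕂 {(fun _ => 1 : Pts p t m → 𝕂)} ⊓
      (Submodule.span 𝕂 (SB p t m d)).map (Th p t m) = ⊥ := by
  have ht : t ≠ 0 := NeZero.ne t
  rw [eq_bot_iff]
  rintro x ⟨hx1, f, hf, rfl⟩
  obtain ⟨c, hc⟩ := Submodule.mem_span_singleton.1 hx1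
  have hfF : f ∈ F1 p t m ^ d := (Submodule.span_le.2 (fun g hg => SB_sub d hg)) hf
  have hinv := F1_pow_inv ht d hd hfF
  have hsum := F1_pow_sum ht d hd2 hfF
  have hval : ∀ v : 𝕍, f v = c * 1 - if v = 0 then c else 0 := by
    intro v
    by_cases hv : v = 0
    · subst hv; simp [hinv.1]
    · rw [if_neg hv, sub_zero, mul_one]
      let Z : Pts p t m := ⟨Submodule.span 𝕂 {v}, finrank_span_singleton hv⟩
      have h1 := congrFun hc Z
      rw [Th_apply] at h1
      obtain ⟨a, ha⟩ := rep_smul Z (Submodule.mem_span_singleton_self v)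
      have ha0 : a ≠ 0 := by rintro rfl; rw [zero_smul] at ha; exact hv ha
      rw [ha, hinv.2 a _ ha0, ← h1]
      simp
  simp only [hval] at hsum
  rw [Finset.sum_sub_distrib, ← Finset.mul_sum, sum_one ht (by omega), mul_zero] at hsum
  have hc0 : c = 0 := by simpa using hsum
  rw [← hc, hc0, zero_smul]
  exact Submodule.zero_mem _

end
end IE

/-- Theorem: for `1 ≤ r ≤ 2m−1`, `r ≠ m`, the span in `k[P]` of the characteristic
functions of the members of `I_r` (totally isotropic `r`-subspaces if `r < m`; perps
of totally isotropic `(2m−r)`-subspaces if `r > m`) is the internal direct sum of the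
constants `k·1` and the span of the functions induced on `P` by the basis monomials
whose `H`-type `s'` lies in `H` and satisfies `s'_j ≤ 2m−r` for all `j`. -/
theorem im_eta_r (p t m : ℕ) [Fact p.Prime] [NeZero t]
    (hodd : Odd p) (ht : 1 ≤ t) (hm : 2 ≤ m)
    (r : ℕ) (hr1 : 1 ≤ r) (hr2 : r ≤ 2 * m - 1) (hrm : r ≠ m) :
    Submodule.span (GaloisField p t)
        {F | ∃ U : Submodule (GaloisField p t) (SympV p t m),
          ((r < m ∧ IsTotIso U ∧ Module.finrank (GaloisField p t) U = r) ∨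
           (m < r ∧ ∃ W : Submodule (GaloisField p t) (SympV p t m),
              IsTotIso W ∧ Module.finrank (GaloisField p t) W = 2 * m - r ∧
              U = sperp W)) ∧
          F = chi U} =
      Submodule.span (GaloisField p t)
          {(fun _ => 1 : Pts p t m → GaloisField p t)} ⊔
        Submodule.span (GaloisField p t)
          {F | ∃ (a b : Fin m → ℕ) (s' : Fin t → ℤ),
            (∀ i, a i ≤ p ^ t - 1) ∧ (∀ i, b i ≤ p ^ t - 1) ∧
            memH p t m s' ∧
            (∀ j : Fin t, (mtype p a b (j : ℕ) : ℤ) =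
              (p : ℤ) * s' (j + 1) - s' j) ∧
            (∀ j, s' j ≤ 2 * m - (r : ℤ)) ∧
            ∀ Z : Pts p t m, ∀ v ∈ Z.val, v ≠ 0 → F Z = bmono a b v}
    ∧ Submodule.span (GaloisField p t)
          {(fun _ => 1 : Pts p t m → GaloisField p t)} ⊓
        Submodule.span (GaloisField p t)
          {F | ∃ (a b : Fin m → ℕ) (s' : Fin t → ℤ),
            (∀ i, a i ≤ p ^ t - 1) ∧ (∀ i, b i ≤ p ^ t - 1) ∧
            memH p t m s' ∧
            (∀ j : Fin t, (mtype p a b (j : ℕ) : ℤ) =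
              (p : ℤ) * s' (j + 1) - s' j) ∧
            (∀ j, s' j ≤ 2 * m - (r : ℤ)) ∧
            ∀ Z : Pts p t m, ∀ v ∈ Z.val, v ≠ 0 → F Z = bmono a b v} = ⊥ := by
  have ht0 : t ≠ 0 := NeZero.ne t
  have hp2 : p ≠ 2 := by rintro rfl; exact absurd hodd (by decide)
  obtain ⟨d, hd⟩ : ∃ d, r + d = 2 * m := ⟨2 * m - r, by omega⟩
  have hd1 : 1 ≤ d := by omega
  rw [← IE.Th_SB d hd1 (2 * m - (r : ℤ)) (by omega), Submodule.span_image]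
  refine ⟨?_, IE.disj d hd1 (by omega)⟩
  let I : Set (Submodule (GaloisField p t) (SympV p t m)) :=
    {U | (r < m ∧ IsTotIso U ∧ Module.finrank (GaloisField p t) U = r) ∨
           (m < r ∧ ∃ W : Submodule (GaloisField p t) (SympV p t m),
              IsTotIso W ∧ Module.finrank (GaloisField p t) W = 2 * m - r ∧
              U = sperp W)}
  have hN := IE.N_eq (p := p) (t := t) (m := m) r d hr1 hd1 hd I ?_ ?_
  · have e1 : {F | ∃ U : Submodule (GaloisField p t) (SympV p t m),
          ((r < m ∧ IsTotIso U ∧ Module.finrank (GaloisField p t) U = r) ∨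
           (m < r ∧ ∃ W : Submodule (GaloisField p t) (SympV p t m),
              IsTotIso W ∧ Module.finrank (GaloisField p t) W = 2 * m - r ∧
              U = sperp W)) ∧
          F = chi U} = Set.image (IE.Th p t m) (Set.image IE.ind I) := by
      ext F
      constructor
      · rintro ⟨U, hU, rfl⟩
        exact ⟨_, ⟨U, hU, rfl⟩, IE.Th_ind U⟩
      · rintro ⟨_, ⟨U, hU, rfl⟩, rfl⟩
        exact ⟨U, hU, IE.Th_ind U⟩
    rw [e1, Submodule.span_image, hN, Submodule.map_sup, ← Submodule.span_image (s := {1}),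
      Set.image_singleton]
    rfl
  · rintro U (⟨_, _, h⟩ | ⟨_, W, _, hW, rfl⟩)
    · exact h
    · have := IE.finrank_sperp W
      omega
  · intro U hU
    rcases lt_or_gt_of_ne hrm with h | h
    · refine IE.linkA ht0 hp2 _ r h ?_ r U hU (by omega)
      intro W h1 h2
      exact Submodule.subset_span ⟨W, Or.inl ⟨h, h1, h2⟩, rfl⟩
    · rw [← IE.sperp_sperp U]
      have h3 := IE.finrank_sperp U
      refine IE.linkB ht0 hp2 _ d (by omega) ?_ d (sperp U) (by omega) (by omega)
      intro W h1 h2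
      exact Submodule.subset_span ⟨sperp W, Or.inr ⟨h, W, h1, by omega, rfl⟩, rfl⟩

end
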